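/- arXiv:1904.00576 — 3 statements merged into one kernel-verified Lean document; each statement's English description precedes it below -/
import Mathlib

section
/- Suppose 0 < p < ∞, r > 0 and μ is a positive Borel measure on 𝒰. Then the following are equivalent: (a) there exists C > 0 such that ∫_𝒰 |f|ᵖ dμ ≤ C ∫_𝒰 |f|ᵖ dV for all f ∈ Aᵖ(𝒰) (μ is a Carleson measure for Aᵖ(𝒰)); (b) there exists C > 0 such that ∫_𝒰 ρ(a)^{n+1}/|ρ(z,a)|^{2(n+1)} dμ(z) ≤ C for all a ∈ 𝒰; (c) there exists C > 0 such that μ(D(a,r)) ≤ C ρ(a)^{n+1} for all a ∈ 𝒰. -/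
open MeasureTheory Filter

noncomputable section

/-- Points of ℂⁿ written `z = (z′, zₙ)` with `z′ ∈ ℂ^m`, `m = n - 1`. -/
abbrev SPoint (m : ℕ) := (Fin m → ℂ) × ℂ

/-- `ρ(z,w) = (i/2)(w̄ₙ − zₙ) − z′·w̄′`. -/
def srho2 {m : ℕ} (z w : SPoint m) : ℂ :=
  Complex.I / 2 * ((starRingEnd ℂ) w.2 - z.2) - ∑ j, z.1 j * (starRingEnd ℂ) (w.1 j)

/-- `ρ(z) = Im zₙ − |z′|²`. -/
def srho {m : ℕ} (z : SPoint m) : ℝ :=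
  z.2.im - ∑ j, ‖z.1 j‖ ^ 2

/-- The Siegel upper half-space `𝒰 = {z : ρ(z) > 0}`. -/
def Siegel (m : ℕ) : Set (SPoint m) := {z | 0 < srho z}

/-- The Bergman kernel `K(z,w) = (n!/(4πⁿ)) ρ(z,w)^{−(n+1)}` (points in ℂⁿ = ℂ^{n-1} × ℂ). -/
def sK (n : ℕ) (z w : SPoint (n - 1)) : ℂ :=
  (n.factorial : ℂ) / (4 * (Real.pi : ℂ) ^ n) * srho2 z w ^ (-(n + 1 : ℤ))

/-- Inverse hyperbolic tangent. -/
def artanh (x : ℝ) : ℝ := (1 / 2) * Real.log ((1 + x) / (1 - x))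

/-- The Bergman distance `β(z,w) = artanh √(1 − ρ(z)ρ(w)/|ρ(z,w)|²)`. -/
def sbeta {m : ℕ} (z w : SPoint m) : ℝ :=
  artanh (Real.sqrt (1 - srho z * srho w / ‖srho2 z w‖ ^ 2))

/-- The Bergman metric ball `D(z,r)`. -/
def sball {m : ℕ} (z : SPoint m) (r : ℝ) : Set (SPoint m) :=
  {w ∈ Siegel m | sbeta z w < r}

/-- Membership in the Bergman space `Aᵖ(𝒰)`: holomorphic with `∫_𝒰 |f|ᵖ dV < ∞`. -/
def MemAp (n : ℕ) (p : ℝ) (f : SPoint (n - 1) → ℂ) : Prop :=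
  DifferentiableOn ℂ f (Siegel (n - 1)) ∧
    IntegrableOn (fun z => ‖f z‖ ^ p) (Siegel (n - 1)) volume

/-- `‖f‖ₚ = (∫_𝒰 |f|ᵖ dV)^{1/p}`. -/
def bNorm (n : ℕ) (p : ℝ) (f : SPoint (n - 1) → ℂ) : ℝ :=
  (∫ z in Siegel (n - 1), ‖f z‖ ^ p) ^ (1 / p)

/-- The space `𝒮_α` of holomorphic `f` on `𝒰` with `sup_z |zₙ + i|^α |f(z)| < ∞`. -/
def SAlpha (n : ℕ) (α : ℝ) (f : SPoint (n - 1) → ℂ) : Prop :=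
  DifferentiableOn ℂ f (Siegel (n - 1)) ∧
    ∃ M : ℝ, ∀ z ∈ Siegel (n - 1), ‖z.2 + Complex.I‖ ^ α * ‖f z‖ ≤ M

end

/-- The mean value inequality for `log ‖g‖`, with `g` holomorphic and `g c ≠ 0`. -/
lemma log_norm_le_circleAverage {g : ℂ → ℂ} {c : ℂ} {R : ℝ} (hR : 0 < R)
    (hg : AnalyticOnNhd ℂ g (Metric.closedBall c |R|)) (h0 : g c ≠ 0) :
    Real.log ‖g c‖ ≤ Real.circleAverage (fun z => Real.log ‖g z‖) c R := by
  rw [hg.circleAverage_log_norm hR.ne' h0]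
  refine le_add_of_nonneg_left (finsum_nonneg fun u => ?_)
  by_cases hu : u ∈ Metric.closedBall c |R|
  · refine mul_nonneg (mod_cast MeromorphicOn.AnalyticOnNhd.divisor_nonneg hg u) ?_
    rcases eq_or_ne u c with rfl | hne
    · simp
    · have hpos : 0 < ‖c - u‖ := norm_pos_iff.2 (sub_ne_zero.2 hne.symm)
      rw [abs_of_pos hR, Metric.mem_closedBall, dist_eq_norm, norm_sub_rev] at hu
      apply Real.log_nonneg
      rwa [← div_eq_mul_inv, one_le_div hpos]
  · simp [hu]

/-- The mean value inequality for `‖g‖ᵖ`, with `g` holomorphic and `0 < p`. -/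
lemma norm_rpow_le_circleAverage {g : ℂ → ℂ} {c : ℂ} {R : ℝ} (hR : 0 < R) {p : ℝ} (hp : 0 < p)
    (hg : AnalyticOnNhd ℂ g (Metric.closedBall c |R|)) :
    ‖g c‖ ^ p ≤ Real.circleAverage (fun z => ‖g z‖ ^ p) c R := by
  by_cases h0 : g c = 0
  · rw [h0, norm_zero, Real.zero_rpow hp.ne']
    exact Real.circleAverage_nonneg_of_nonneg fun x _ => by positivity
  have hsub := Metric.sphere_subset_closedBall (x := c) (ε := |R|)
  have hne : ∀ᶠ z in codiscreteWithin (Metric.sphere c |R|), g z ≠ 0 := by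
    refine (hg.mono hsub).meromorphicOn.eventually_codiscreteWithin_apply_ne_zero
      fun x hx htop => h0 ?_
    exact hg.eqOn_zero_of_preconnected_of_frequently_eq_zero
      (convex_closedBall c |R|).isPreconnected (hsub hx)
      (meromorphicOrderAt_eq_top_iff.1 htop).frequently (Metric.mem_closedBall_self (abs_nonneg R))
  have hcont : ContinuousOn (fun z => ‖g z‖ ^ p) (Metric.sphere c |R|) :=
    ((hg.mono hsub).continuousOn.norm).rpow_const fun _ _ => Or.inr hp.le
  have hint : CircleIntegrable (fun z => ‖g z‖ ^ p) c R := hcont.circleIntegrable'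
  have hexp : (fun z => ‖g z‖ ^ p) =ᶠ[codiscreteWithin (Metric.sphere c |R|)]
      fun z => Real.exp (p * Real.log ‖g z‖) := by
    filter_upwards [hne] with z hz
    rw [Real.rpow_def_of_pos (norm_pos_iff.2 hz), mul_comm]
  have hint' : CircleIntegrable (fun z => Real.exp (p * Real.log ‖g z‖)) c R :=
    hint.congr_codiscreteWithin hexp
  have hlog : CircleIntegrable (fun z => Real.log ‖g z‖) c R :=
    (hg.mono hsub).meromorphicOn.circleIntegrable_log_norm
  rw [Real.circleAverage_congr_codiscreteWithin hexp hR.ne']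
  set L := Real.log ‖g c‖
  have htangent : ∀ z, Real.exp (p * L) * (1 - p * L) + (Real.exp (p * L) * p) * Real.log ‖g z‖
      ≤ Real.exp (p * Real.log ‖g z‖) := fun z => by
    have h1 := Real.add_one_le_exp (p * Real.log ‖g z‖ - p * L)
    have h2 : Real.exp (p * Real.log ‖g z‖)
        = Real.exp (p * L) * Real.exp (p * Real.log ‖g z‖ - p * L) := by
      rw [← Real.exp_add]; ring_nf
    rw [h2]
    nlinarith [mul_le_mul_of_nonneg_left h1 (Real.exp_pos (p * L)).le]
  have hmul : CircleIntegrable (fun z => (Real.exp (p * L) * p) * Real.log ‖g z‖) c R :=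
    hlog.const_mul _
  have hconst : CircleIntegrable (fun _ : ℂ => Real.exp (p * L) * (1 - p * L)) c R :=
    circleIntegrable_const _ _ _
  have hmono := Real.circleAverage_mono (hconst.add hmul) hint' fun z _ => htangent z
  have hadd := Real.circleAverage_add hconst hmul
  have hs := Real.circleAverage_smul (a := Real.exp (p * L) * p)
    (f := fun z => Real.log ‖g z‖) (c := c) (R := R)
  have hm := log_norm_le_circleAverage hR hg h0
  have hs' : Real.circleAverage (fun z => (Real.exp (p * L) * p) * Real.log ‖g z‖) c R
      = (Real.exp (p * L) * p) * Real.circleAverage (fun z => Real.log ‖g z‖) c R := hs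
  rw [hadd, Real.circleAverage_const, hs'] at hmono
  have hL : ‖g c‖ ^ p = Real.exp (p * L) := by
    rw [Real.rpow_def_of_pos (norm_pos_iff.2 h0), mul_comm]
  rw [hL]
  refine le_trans ?_ hmono
  nlinarith [mul_le_mul_of_nonneg_left hm (mul_pos (Real.exp_pos (p * L)) hp).le]

section Geometry

variable {m : ℕ}

lemma srho2_re (z w : SPoint m) :
    (srho2 z w).re = (srho z + srho w + ∑ j, ‖z.1 j - w.1 j‖ ^ 2) / 2 := by
  have h : ∑ j, ‖z.1 j - w.1 j‖ ^ 2 = ∑ j, ‖z.1 j‖ ^ 2 + ∑ j, ‖w.1 j‖ ^ 2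
      - 2 * ∑ j, (z.1 j * (starRingEnd ℂ) (w.1 j)).re := by
    rw [Finset.mul_sum, ← Finset.sum_add_distrib, ← Finset.sum_sub_distrib]
    refine Finset.sum_congr rfl fun j _ => ?_
    simp only [Complex.sq_norm, Complex.normSq_sub]
  rw [h]
  simp only [srho2, srho, Complex.sub_re, Complex.re_sum, Complex.mul_re, Complex.div_re,
    Complex.div_im, Complex.I_re, Complex.I_im, Complex.sub_im, Complex.conj_im, Complex.conj_re]
  norm_num
  ring

lemma srho2_im (z w : SPoint m) :
    (srho2 z w).im = (w.2.re - z.2.re) / 2 - ∑ j, (z.1 j * (starRingEnd ℂ) (w.1 j)).im := by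
  simp only [srho2, Complex.sub_im, Complex.im_sum, Complex.mul_im, Complex.div_re,
    Complex.div_im, Complex.I_re, Complex.I_im, Complex.sub_re, Complex.conj_im, Complex.conj_re]
  norm_num
  ring

lemma srho2_conj (z w : SPoint m) : (starRingEnd ℂ) (srho2 z w) = srho2 w z := by
  simp only [srho2, map_sub, map_mul, map_div₀, map_sum, Complex.conj_I, Complex.conj_conj,
    map_ofNat]
  congr 1
  · ring
  · exact Finset.sum_congr rfl fun j _ => mul_comm _ _

lemma norm_srho2_comm (z w : SPoint m) : ‖srho2 z w‖ = ‖srho2 w z‖ := by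
  rw [← srho2_conj z w, Complex.norm_conj]

lemma half_add_le_norm_srho2 (z w : SPoint m) : (srho z + srho w) / 2 ≤ ‖srho2 z w‖ := by
  refine le_trans ?_ (Complex.re_le_norm _)
  rw [srho2_re]
  have : 0 ≤ ∑ j, ‖z.1 j - w.1 j‖ ^ 2 := Finset.sum_nonneg fun _ _ => by positivity
  linarith

lemma norm_srho2_pos {z w : SPoint m} (hz : 0 < srho z) (hw : 0 < srho w) :
    0 < ‖srho2 z w‖ := by
  linarith [half_add_le_norm_srho2 z w]

lemma srho2_self (z : SPoint m) : srho2 z z = srho z := by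
  apply Complex.ext
  · simp [srho2_re]
  · simp [srho2_im, mul_comm]

lemma artanh_lt_iff {x r : ℝ} (h0 : 0 ≤ x) (h1 : x < 1) :
    artanh x < r ↔ x < (Real.exp (2 * r) - 1) / (Real.exp (2 * r) + 1) := by
  have he := Real.exp_pos (2 * r)
  have : artanh x < r ↔ Real.log ((1 + x) / (1 - x)) < 2 * r := by
    unfold artanh; constructor <;> intro h <;> linarith
  rw [this, Real.log_lt_iff_lt_exp (div_pos (by linarith) (by linarith)),
    div_lt_iff₀ (by linarith), lt_div_iff₀ (by linarith)]
  constructor <;> intro h <;> nlinarith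

/-- Bergman balls of a fixed radius are described by a polynomial inequality. -/
lemma exists_sbeta_lt_iff {r : ℝ} (hr : 0 < r) : ∃ c : ℝ, 0 < c ∧ c < 1 ∧
    ∀ {m : ℕ} {z w : SPoint m}, 0 < srho z → 0 < srho w →
      (sbeta z w < r ↔ c * ‖srho2 z w‖ ^ 2 < srho z * srho w) := by
  set T := (Real.exp (2 * r) - 1) / (Real.exp (2 * r) + 1) with hT
  have he : 1 < Real.exp (2 * r) := Real.one_lt_exp_iff.2 (by linarith)
  have hT0 : 0 < T := div_pos (by linarith) (by linarith)
  have hT1 : T < 1 := by rw [hT, div_lt_one (by linarith)]; linarith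
  refine ⟨1 - T ^ 2, by nlinarith, by nlinarith, fun {m z w} hz hw => ?_⟩
  have hn := norm_srho2_pos hz hw
  have hq : 0 < srho z * srho w / ‖srho2 z w‖ ^ 2 := by positivity
  have hs : Real.sqrt (1 - srho z * srho w / ‖srho2 z w‖ ^ 2) < 1 := by
    rw [Real.sqrt_lt' one_pos]; linarith
  rw [sbeta, artanh_lt_iff (Real.sqrt_nonneg _) hs, ← hT, Real.sqrt_lt' hT0, sub_lt_comm,
    lt_div_iff₀ (by positivity)]

lemma srho_continuous : Continuous (srho : SPoint m → ℝ) := by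
  unfold srho; fun_prop

lemma srho2_continuous : Continuous fun q : SPoint m × SPoint m => srho2 q.1 q.2 := by
  unfold srho2
  have := Complex.continuous_conj
  fun_prop

lemma srho2_differentiable (a : SPoint m) : Differentiable ℂ fun z => srho2 z a := by
  unfold srho2; fun_prop

lemma isOpen_siegel : IsOpen (Siegel m) := isOpen_lt continuous_const srho_continuous

/-- If `c ‖ρ(z,w)‖² < ρ(z) ρ(w)` then `‖ρ(z,w)‖` is controlled by `ρ(w)`. -/
lemma norm_srho2_le {c : ℝ} (hc : 0 < c) {z w : SPoint m} (hz : 0 < srho z) (hw : 0 < srho w)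
    (h : c * ‖srho2 z w‖ ^ 2 < srho z * srho w) : ‖srho2 z w‖ ≤ 2 / c * srho w := by
  have hn := norm_srho2_pos hz hw
  have h1 := half_add_le_norm_srho2 z w
  rw [div_mul_eq_mul_div, le_div_iff₀ hc]
  by_contra! hlt
  nlinarith [mul_lt_mul_of_pos_left hlt hn, mul_le_mul_of_nonneg_right
    (show srho z ≤ 2 * ‖srho2 z w‖ by linarith) hw.le]

end Geometry

section SubMeanValue

variable {m : ℕ}

lemma measurePreserving_circle_smul (a : Circle) :
    MeasurePreserving (fun u : SPoint m => (a : ℂ) • u) := by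
  have h : MeasurePreserving (fun w : ℂ => (a : ℂ) * w) := (rotation a).measurePreserving
  exact (volume_preserving_pi fun _ => h).prod h

lemma measurable_indicator_norm_rpow {X : Type*} [TopologicalSpace X] [MeasurableSpace X]
    [BorelSpace X] {p : ℝ} (hp : 0 < p) {f : X → ℂ} {s : Set X} (hs : MeasurableSet s)
    (hf : ContinuousOn f s) : Measurable (s.indicator fun u => ENNReal.ofReal (‖f u‖ ^ p)) := by
  classical
  have hcont : ContinuousOn (fun u => ENNReal.ofReal (‖f u‖ ^ p)) s :=
    ENNReal.continuous_ofReal.comp_continuousOn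
      (hf.norm.rpow_const fun _ _ => Or.inr hp.le)
  rw [← Set.piecewise_eq_indicator]
  exact hcont.measurable_piecewise continuousOn_const hs

/-- The mean value inequality for `‖G‖ᵖ` on the unit polydisc. -/
lemma norm_rpow_mul_volume_ball_le {p : ℝ} (hp : 0 < p) {G : SPoint m → ℂ}
    (hG : DifferentiableOn ℂ G (Metric.ball 0 1)) :
    ENNReal.ofReal (‖G 0‖ ^ p) * volume (Metric.ball (0 : SPoint m) 1) ≤
      ∫⁻ u in Metric.ball 0 1, ENNReal.ofReal (‖G u‖ ^ p) := by
  have hball : MeasurableSet (Metric.ball (0 : SPoint m) 1) := measurableSet_ball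
  set H : SPoint m → ENNReal :=
    (Metric.ball 0 1).indicator fun u => ENNReal.ofReal (‖G u‖ ^ p) with hH
  have hHmeas : Measurable H :=
    measurable_indicator_norm_rpow hp hball hG.continuousOn
  have hcircle : ∀ u ∈ Metric.ball (0 : SPoint m) 1, ENNReal.ofReal (2 * Real.pi) *
      ENNReal.ofReal (‖G 0‖ ^ p) ≤
        ∫⁻ θ in Set.Ioc 0 (2 * Real.pi), H (circleMap 0 1 θ • u) := by
    intro u hu
    have hopen : IsOpen {l : ℂ | l • u ∈ Metric.ball (0 : SPoint m) 1} :=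
      Metric.isOpen_ball.preimage (by fun_prop : Continuous fun l : ℂ => l • u)
    have hsub : Metric.closedBall (0 : ℂ) |1| ⊆ {l : ℂ | l • u ∈ Metric.ball (0 : SPoint m) 1} := by
      intro l hl
      simp only [abs_one, mem_closedBall_zero_iff, mem_ball_zero_iff, Set.mem_ofPred_eq,
        norm_smul] at hl hu ⊢
      nlinarith [norm_nonneg u, norm_nonneg l]
    have hg : AnalyticOnNhd ℂ (fun l : ℂ => G (l • u)) (Metric.closedBall 0 |1|) := by
      refine AnalyticOnNhd.mono (DifferentiableOn.analyticOnNhd ?_ hopen) hsub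
      exact hG.comp (Differentiable.differentiableOn (by fun_prop)) fun l hl => hl
    have hle := norm_rpow_le_circleAverage one_pos hp hg
    have hcont : Continuous fun θ : ℝ => ‖G (circleMap 0 1 θ • u)‖ ^ p := by
      have h1 : ContinuousOn (fun l : ℂ => ‖G (l • u)‖ ^ p) (Metric.closedBall 0 |1|) :=
        hg.continuousOn.norm.rpow_const fun _ _ => Or.inr hp.le
      exact h1.comp_continuous (continuous_circleMap 0 1) fun θ => by simp
    rw [Real.circleAverage, intervalIntegral.integral_of_le (by positivity), zero_smul,
      smul_eq_mul, ← div_eq_inv_mul, le_div_iff₀ (by positivity), mul_comm] at hle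
    rw [← ENNReal.ofReal_mul (by positivity)]
    refine (ENNReal.ofReal_le_ofReal hle).trans ?_
    rw [ofReal_integral_eq_lintegral_ofReal
      ((hcont.integrableOn_Icc).mono_set Set.Ioc_subset_Icc_self)
      (ae_of_all _ fun θ => by positivity)]
    refine lintegral_mono fun θ => ?_
    have hmem : circleMap 0 1 θ • u ∈ Metric.ball (0 : SPoint m) 1 :=
      hsub (by simp : circleMap 0 1 θ ∈ _)
    rw [hH, Set.indicator_of_mem hmem]
  have hswap : ∫⁻ u : SPoint m, ∫⁻ θ in Set.Ioc 0 (2 * Real.pi), H (circleMap 0 1 θ • u)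
      = ENNReal.ofReal (2 * Real.pi) * ∫⁻ u, H u := by
    rw [lintegral_lintegral_swap]
    · have : ∀ θ : ℝ, ∫⁻ u : SPoint m, H (circleMap 0 1 θ • u) = ∫⁻ u, H u := fun θ => by
        have h1 := (measurePreserving_circle_smul (m := m) (Circle.exp θ)).lintegral_comp hHmeas
        simpa [circleMap, Circle.coe_exp] using h1
      simp_rw [this]
      simp [mul_comm]
    · apply Measurable.aemeasurable
      apply hHmeas.comp
      apply Continuous.measurable
      fun_prop
  have hpi : ENNReal.ofReal (2 * Real.pi) ≠ 0 := by simp [Real.pi_pos]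
  rw [← lintegral_indicator hball, ← hH,
    ← ENNReal.mul_le_mul_iff_right hpi ENNReal.ofReal_ne_top, ← hswap, ← mul_assoc,
    ← setLIntegral_const, ← lintegral_indicator hball]
  refine lintegral_mono fun u => ?_
  by_cases hu : u ∈ Metric.ball (0 : SPoint m) 1
  · rw [Set.indicator_of_mem hu]
    exact hcircle u hu
  · simp [hu]

lemma lintegral_comp_add_smul {E : Type*} [NormedAddCommGroup E] [NormedSpace ℝ E]
    [MeasureSpace E] [BorelSpace E] [FiniteDimensional ℝ E]
    [(volume : Measure E).IsAddHaarMeasure] {F : E → ENNReal} (hF : Measurable F) (b : E) {s : ℝ}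
    (hs : 0 < s) : ∫⁻ u, F (b + s • u) =
      ENNReal.ofReal ((s ^ Module.finrank ℝ E)⁻¹) * ∫⁻ u, F u := by
  have h1 : Measurable fun u => F (b + u) := hF.comp (measurable_const_add b)
  rw [← lintegral_map (f := fun u => F (b + u)) (g := fun u : E => s • u) h1
    (measurable_const_smul s), Measure.map_addHaar_smul _ hs.ne', lintegral_smul_measure,
    lintegral_add_left_eq_self, abs_of_pos (by positivity), smul_eq_mul]

/-- Change of variables for an affine map of triangular form. -/
lemma lintegral_comp_triangular {F : SPoint m → ENNReal} (hF : Measurable F) (b : Fin m → ℂ)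
    {L : (Fin m → ℂ) → ℂ} (hL : Measurable L) {s t : ℝ} (hs : 0 < s) (ht : 0 < t) :
    ∫⁻ u : SPoint m, F (b + s • u.1, L u.1 + t • u.2) =
      ENNReal.ofReal ((s ^ (2 * m))⁻¹ * (t ^ 2)⁻¹) * ∫⁻ u, F u := by
  have hφ : Measurable fun u : SPoint m => F (b + s • u.1, L u.1 + t • u.2) := by
    apply hF.comp
    fun_prop
  rw [Measure.volume_eq_prod, lintegral_prod _ hφ.aemeasurable, lintegral_prod _ hF.aemeasurable]
  have hinner : ∀ x : Fin m → ℂ, ∫⁻ y : ℂ, F (b + s • x, L x + t • y) =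
      ENNReal.ofReal ((t ^ 2)⁻¹) * ∫⁻ y : ℂ, F (b + s • x, y) := fun x => by
    rw [lintegral_comp_add_smul (F := fun y : ℂ => F (b + s • x, y))
      (hF.comp measurable_prodMk_left) _ ht, Complex.finrank_real_complex]
  simp_rw [hinner]
  have hG : Measurable fun x : Fin m → ℂ => ∫⁻ y : ℂ, F (x, y) := hF.lintegral_prod_right'
  have hG' : Measurable fun x : Fin m → ℂ => ∫⁻ y : ℂ, F (b + s • x, y) :=
    hG.comp (by fun_prop : Measurable fun x : Fin m → ℂ => b + s • x)
  rw [lintegral_const_mul _ hG', lintegral_comp_add_smul hG b hs,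
    ENNReal.ofReal_mul (by positivity), ← mul_assoc, mul_comm (ENNReal.ofReal _)]
  simp [Module.finrank_pi_fintype, Complex.finrank_real_complex, mul_comm]

end SubMeanValue

section LocalEstimate

variable {m : ℕ}

/-- The affine chart at `z`, carrying a fixed polydisc centred at `0` to a neighbourhood of `z`
whose size in the Bergman metric does not depend on `z`. -/
noncomputable def siegelChart (z : SPoint m) (ε : ℝ) (u : SPoint m) : SPoint m :=
  (z.1 + (√(srho z) * ε) • u.1,
    (z.2 + 2 * Complex.I * ∑ j, ((√(srho z) * ε : ℝ) : ℂ) * u.1 j * (starRingEnd ℂ) (z.1 j)) +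
      (srho z * ε) • u.2)

lemma siegelChart_zero (z : SPoint m) (ε : ℝ) : siegelChart z ε 0 = z := by
  simp [siegelChart]

lemma siegelChart_differentiable (z : SPoint m) (ε : ℝ) :
    Differentiable ℂ (siegelChart z ε) := by
  unfold siegelChart; fun_prop

lemma srho2_siegelChart (z : SPoint m) (ε : ℝ) (u : SPoint m) :
    srho2 (siegelChart z ε u) z = srho z * (1 - Complex.I / 2 * ε * u.2) := by
  have h := srho2_self z
  simp only [srho2, siegelChart, Pi.add_apply, Pi.smul_apply, Complex.real_smul, add_mul,
    Finset.sum_add_distrib] at h ⊢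
  push_cast
  linear_combination h - (∑ j, (√(srho z) : ℂ) * ε * u.1 j * (starRingEnd ℂ) (z.1 j)) *
    Complex.I_sq

lemma srho_siegelChart {z : SPoint m} (hz : 0 < srho z) (ε : ℝ) (u : SPoint m) :
    srho (siegelChart z ε u) =
      srho z * (1 + ε * u.2.im - ε ^ 2 * ∑ j, ‖u.1 j‖ ^ 2) := by
  have h1 := srho2_re (siegelChart z ε u) z
  have h2 : ∑ j, ‖(siegelChart z ε u).1 j - z.1 j‖ ^ 2
      = srho z * ε ^ 2 * ∑ j, ‖u.1 j‖ ^ 2 := by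
    rw [Finset.mul_sum]
    refine Finset.sum_congr rfl fun j _ => ?_
    simp only [siegelChart, Pi.add_apply, Pi.smul_apply, add_sub_cancel_left, norm_smul, mul_pow,
      Real.norm_eq_abs, sq_abs, abs_mul, Real.sq_sqrt hz.le]
  rw [h2, srho2_siegelChart] at h1
  have h3 : (srho z * (1 - Complex.I / 2 * ε * u.2) : ℂ).re
      = srho z * (1 + ε * u.2.im / 2) := by
    rw [Complex.re_ofReal_mul]
    congr 1
    simp
    ring
  rw [h3] at h1
  linarith

lemma siegelChart_mem {c ε : ℝ} (hc : 0 < c) (hε : 0 < ε)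
    (h : c * (1 + ε / 2) ^ 2 < 1 - ε - ε ^ 2 * m) {z : SPoint m} (hz : 0 < srho z)
    {u : SPoint m} (hu : ‖u‖ ≤ 1) :
    0 < srho (siegelChart z ε u) ∧
      c * ‖srho2 z (siegelChart z ε u)‖ ^ 2 < srho z * srho (siegelChart z ε u) := by
  have hu1 : ∑ j, ‖u.1 j‖ ^ 2 ≤ m := by
    calc ∑ j, ‖u.1 j‖ ^ 2 ≤ ∑ _j : Fin m, (1 : ℝ) := Finset.sum_le_sum fun j _ =>
          pow_le_one₀ (norm_nonneg _) ((norm_le_pi_norm u.1 j).trans ((norm_fst_le u).trans hu))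
      _ = m := by simp
  have hu2 : ‖u.2‖ ≤ 1 := (norm_snd_le u).trans hu
  have him : -1 ≤ u.2.im := by
    have := (abs_le.1 (Complex.abs_im_le_norm u.2)).1
    linarith
  have hlow : 1 - ε - ε ^ 2 * m ≤ 1 + ε * u.2.im - ε ^ 2 * ∑ j, ‖u.1 j‖ ^ 2 := by
    nlinarith [mul_le_mul_of_nonneg_left hu1 (sq_nonneg ε), mul_le_mul_of_nonneg_left him hε.le]
  have hpos : 0 < c * (1 + ε / 2) ^ 2 := by positivity
  have hnorm : ‖srho2 z (siegelChart z ε u)‖ ≤ srho z * (1 + ε / 2) := by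
    rw [norm_srho2_comm, srho2_siegelChart, norm_mul, Complex.norm_real,
      Real.norm_of_nonneg hz.le]
    refine mul_le_mul_of_nonneg_left ((norm_sub_le _ _).trans ?_) hz.le
    simp only [norm_one, norm_mul, norm_div, Complex.norm_I, Complex.norm_real,
      Real.norm_of_nonneg hε.le, Complex.norm_ofNat]
    nlinarith [mul_le_mul_of_nonneg_left hu2 hε.le]
  rw [srho_siegelChart hz]
  refine ⟨mul_pos hz (by linarith), ?_⟩
  calc c * ‖srho2 z (siegelChart z ε u)‖ ^ 2
      ≤ c * (srho z * (1 + ε / 2)) ^ 2 := by gcongr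
    _ = srho z ^ 2 * (c * (1 + ε / 2) ^ 2) := by ring
    _ < srho z ^ 2 * (1 + ε * u.2.im - ε ^ 2 * ∑ j, ‖u.1 j‖ ^ 2) := by
        gcongr; linarith
    _ = _ := by ring

lemma exists_chart_radius {c : ℝ} (hc1 : c < 1) (m : ℕ) :
    ∃ ε : ℝ, 0 < ε ∧ c * (1 + ε / 2) ^ 2 < 1 - ε - ε ^ 2 * m := by
  have h1 : ContinuousAt (fun ε : ℝ => c * (1 + ε / 2) ^ 2) 0 := by fun_prop
  have h2 : ContinuousAt (fun ε : ℝ => 1 - ε - ε ^ 2 * m) 0 := by fun_prop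
  have h := (h1.eventually_lt h2 (by simpa using hc1)).filter_mono
    (nhdsWithin_le_nhds (s := Set.Ioi 0))
  obtain ⟨ε, hlt, hpos⟩ := (h.and self_mem_nhdsWithin).exists
  exact ⟨ε, hpos, hlt⟩

lemma isOpen_bergman (c : ℝ) : IsOpen {q : SPoint m × SPoint m | 0 < srho q.1 ∧ 0 < srho q.2 ∧
    c * ‖srho2 q.1 q.2‖ ^ 2 < srho q.1 * srho q.2} := by
  have hcont2 := srho2_continuous (m := m)
  have hcont := srho_continuous (m := m)
  refine IsOpen.and ?_ (IsOpen.and ?_ ?_) <;> exact isOpen_lt (by fun_prop) (by fun_prop)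

lemma isOpen_bergman_section (c : ℝ) (z : SPoint m) :
    IsOpen {w : SPoint m | 0 < srho w ∧ c * ‖srho2 z w‖ ^ 2 < srho z * srho w} := by
  have hcont2 : Continuous fun w : SPoint m => srho2 z w :=
    srho2_continuous.comp (by fun_prop : Continuous fun w : SPoint m => (z, w))
  have hcont := srho_continuous (m := m)
  refine IsOpen.and ?_ ?_ <;> exact isOpen_lt (by fun_prop) (by fun_prop)

/-- The local mean value inequality for `‖f‖ᵖ` over Bergman balls. -/
lemma exists_norm_rpow_le {p : ℝ} (hp : 0 < p) {c : ℝ} (hc : 0 < c) (hc1 : c < 1) (m : ℕ) :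
    ∃ K : ENNReal, K ≠ ⊤ ∧ ∀ f : SPoint m → ℂ, DifferentiableOn ℂ f (Siegel m) →
      ∀ z ∈ Siegel m, ENNReal.ofReal (‖f z‖ ^ p) ≤
        K * ENNReal.ofReal ((srho z ^ (m + 2))⁻¹) *
          ∫⁻ w in {w | 0 < srho w ∧ c * ‖srho2 z w‖ ^ 2 < srho z * srho w},
            ENNReal.ofReal (‖f w‖ ^ p) := by
  obtain ⟨ε, hε, hlt⟩ := exists_chart_radius hc1 m
  set v := volume (Metric.ball (0 : SPoint m) 1) with hv
  have hv0 : v ≠ 0 := (Metric.measure_ball_pos volume _ one_pos).ne'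
  have hvtop : v ≠ ⊤ := measure_ball_lt_top.ne
  refine ⟨v⁻¹ * ENNReal.ofReal ((ε ^ (2 * m + 2))⁻¹),
    ENNReal.mul_ne_top (ENNReal.inv_ne_top.2 hv0) ENNReal.ofReal_ne_top, fun f hf z hz => ?_⟩
  have hz' : 0 < srho z := hz
  set S := {w : SPoint m | 0 < srho w ∧ c * ‖srho2 z w‖ ^ 2 < srho z * srho w}
  have hSm : MeasurableSet S := (isOpen_bergman_section c z).measurableSet
  have hmem : ∀ u ∈ Metric.ball (0 : SPoint m) 1, siegelChart z ε u ∈ S := fun u hu =>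
    siegelChart_mem hc hε hlt hz' (mem_ball_zero_iff.1 hu).le
  set F := S.indicator fun w => ENNReal.ofReal (‖f w‖ ^ p) with hF
  have hFm : Measurable F :=
    measurable_indicator_norm_rpow hp hSm (hf.continuousOn.mono fun w hw => hw.1)
  have hmean := norm_rpow_mul_volume_ball_le hp (G := fun u => f (siegelChart z ε u))
    (hf.comp (siegelChart_differentiable z ε).differentiableOn fun u hu => (hmem u hu).1)
  have hle : ∫⁻ u in Metric.ball (0 : SPoint m) 1, ENNReal.ofReal (‖f (siegelChart z ε u)‖ ^ p) ≤
      ∫⁻ u, F (siegelChart z ε u) := by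
    rw [← lintegral_indicator measurableSet_ball]
    refine lintegral_mono fun u => ?_
    by_cases hu : u ∈ Metric.ball (0 : SPoint m) 1
    · rw [Set.indicator_of_mem hu, hF, Set.indicator_of_mem (hmem u hu)]
    · simp [hu]
  have hcov : ∫⁻ u, F (siegelChart z ε u) = _ :=
    lintegral_comp_triangular hFm z.1
      (L := fun x => z.2 + 2 * Complex.I *
        ∑ j, ((√(srho z) * ε : ℝ) : ℂ) * x j * (starRingEnd ℂ) (z.1 j))
      (by fun_prop) (s := √(srho z) * ε) (t := srho z * ε) (by positivity) (by positivity)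
  have hconst : ((√(srho z) * ε) ^ (2 * m))⁻¹ * ((srho z * ε) ^ 2)⁻¹ =
      (ε ^ (2 * m + 2))⁻¹ * (srho z ^ (m + 2))⁻¹ := by
    rw [mul_pow, pow_mul (√(srho z)), Real.sq_sqrt hz'.le, ← mul_inv, ← mul_inv]
    congr 1
    ring
  rw [hcov, hconst, ENNReal.ofReal_mul (by positivity), hF, lintegral_indicator hSm] at hle
  rw [siegelChart_zero] at hmean
  have hfinal := hmean.trans hle
  rw [← hv, ← ENNReal.le_div_iff_mul_le (Or.inl hv0) (Or.inl hvtop), div_eq_mul_inv,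
    mul_comm _ v⁻¹] at hfinal
  simpa only [mul_assoc] using hfinal

end LocalEstimate

section Carleson

variable {m : ℕ}

lemma sbeta_self_lt {r : ℝ} (hr : 0 < r) {z : SPoint m} (hz : 0 < srho z) : sbeta z z < r := by
  obtain ⟨c, -, hc1, h⟩ := exists_sbeta_lt_iff hr
  rw [h hz hz, srho2_self, Complex.norm_real, Real.norm_of_nonneg hz.le]
  nlinarith [mul_pos hz hz]

/-- A measure that is finite on Bergman balls is σ-finite on the Siegel domain. -/
lemma sigmaFinite_restrict_siegel {r : ℝ} (hr : 0 < r) {μ : Measure (SPoint m)}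
    (hμ : ∀ a ∈ Siegel m, μ (sball a r) < ⊤) : SigmaFinite (μ.restrict (Siegel m)) := by
  have hnhds : ∀ a ∈ Siegel m, sball a r ∈ nhdsWithin a (Siegel m) := by
    intro a ha
    have ha' : 0 < srho a := ha
    obtain ⟨c, -, -, h⟩ := exists_sbeta_lt_iff hr
    have hmem := (h ha' ha').1 (sbeta_self_lt hr ha')
    filter_upwards [mem_nhdsWithin_of_mem_nhds
      ((isOpen_bergman_section c a).mem_nhds ⟨ha', hmem⟩)] with w hw
    exact ⟨hw.1, (h ha' hw.1).2 hw.2⟩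
  obtain ⟨t, ht, htc, hcover⟩ := TopologicalSpace.countable_cover_nhdsWithin hnhds
  refine Measure.sigmaFinite_of_countable
    (S := insert (Siegel m)ᶜ ((fun a => sball a r) '' t)) ((htc.image _).insert _) ?_ ?_
  · rintro s (rfl | ⟨a, ha, rfl⟩)
    · rw [Measure.restrict_apply isOpen_siegel.measurableSet.compl]
      simp
    · exact (Measure.restrict_apply_le _ _).trans_lt (hμ a (ht ha))
  · refine Set.eq_univ_of_forall fun x => ?_
    by_cases hx : x ∈ Siegel m
    · obtain ⟨a, ha, hxa⟩ := Set.mem_iUnion₂.1 (hcover hx)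
      exact ⟨_, Or.inr ⟨a, ha, rfl⟩, hxa⟩
    · exact ⟨_, Or.inl rfl, hx⟩

/-- The ball condition implies the Carleson embedding. -/
lemma carleson_of_ball {p : ℝ} (hp : 0 < p) {r : ℝ} (hr : 0 < r) {μ : Measure (SPoint m)} {C : ℝ}
    (hC : 0 < C) (hμ : ∀ a ∈ Siegel m, μ (sball a r) ≤ ENNReal.ofReal (C * srho a ^ (m + 2))) :
    ∃ C : ℝ, 0 < C ∧ ∀ f : SPoint m → ℂ, DifferentiableOn ℂ f (Siegel m) →
      ∫⁻ z in Siegel m, ENNReal.ofReal (‖f z‖ ^ p) ∂μ ≤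
        ENNReal.ofReal C * ∫⁻ z in Siegel m, ENNReal.ofReal (‖f z‖ ^ p) := by
  obtain ⟨c, hc, hc1, hball⟩ := exists_sbeta_lt_iff hr
  obtain ⟨K, hK, hloc⟩ := exists_norm_rpow_le hp hc hc1 m
  have : SigmaFinite (μ.restrict (Siegel m)) :=
    sigmaFinite_restrict_siegel hr fun a ha => (hμ a ha).trans_lt ENNReal.ofReal_lt_top
  refine ⟨K.toReal * ((4 / c) ^ (m + 2) * C) + 1, by positivity, fun f hf => ?_⟩
  have hSm : MeasurableSet (Siegel m) := isOpen_siegel.measurableSet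
  set F := (Siegel m).indicator fun w => ENNReal.ofReal (‖f w‖ ^ p) with hF
  have hFm : Measurable F := measurable_indicator_norm_rpow hp hSm hf.continuousOn
  set E := {q : SPoint m × SPoint m | 0 < srho q.1 ∧ 0 < srho q.2 ∧
    c * ‖srho2 q.1 q.2‖ ^ 2 < srho q.1 * srho q.2}
  have hEm : MeasurableSet E := (isOpen_bergman c).measurableSet
  set k : SPoint m × SPoint m → ENNReal := E.indicator fun q =>
    K * ENNReal.ofReal ((srho q.1 ^ (m + 2))⁻¹) * F q.2 with hk
  have hkm : Measurable k := by
    have := (srho_continuous (m := m)).measurable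
    refine Measurable.indicator ?_ hEm
    fun_prop
  have hpoint : ∀ z ∈ Siegel m, ENNReal.ofReal (‖f z‖ ^ p) ≤ ∫⁻ w, k (z, w) := by
    intro z hz
    refine (hloc f hf z hz).trans ?_
    rw [← lintegral_const_mul' _ _ (ENNReal.mul_ne_top hK ENNReal.ofReal_ne_top),
      ← lintegral_indicator (isOpen_bergman_section c z).measurableSet]
    refine lintegral_mono fun w => ?_
    by_cases hw : 0 < srho w ∧ c * ‖srho2 z w‖ ^ 2 < srho z * srho w
    · rw [Set.indicator_of_mem (by exact hw), hk, Set.indicator_of_mem (by exact ⟨hz, hw⟩), hF,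
        Set.indicator_of_mem (by exact hw.1)]
    · rw [Set.indicator_of_notMem (by exact hw)]
      exact zero_le
  have hinner : ∀ w, ∫⁻ z in Siegel m, k (z, w) ∂μ ≤
      K * ENNReal.ofReal ((4 / c) ^ (m + 2) * C) * F w := by
    intro w
    by_cases hw : w ∈ Siegel m
    swap
    · have : ∀ z, k (z, w) = 0 := fun z => Set.indicator_of_notMem (fun h => hw h.2.1) _
      simp [this]
    have hw' : 0 < srho w := hw
    have hbound : ∀ z, k (z, w) ≤ (sball w r).indicator
        (fun _ => K * ENNReal.ofReal ((4 / c) ^ (m + 2) * (srho w ^ (m + 2))⁻¹) * F w) z := by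
      intro z
      by_cases hq : (z, w) ∈ E
      · have hz : 0 < srho z := hq.1
        have hq' : c * ‖srho2 w z‖ ^ 2 < srho w * srho z := by
          rw [norm_srho2_comm, mul_comm (srho w)]; exact hq.2.2
        have hmem : z ∈ sball w r := ⟨hz, (hball hw' hz).2 hq'⟩
        have hcomp : srho w ≤ 4 / c * srho z := by
          have h1 := norm_srho2_le hc hw' hz hq'
          have h2 := half_add_le_norm_srho2 w z
          have : 4 / c * srho z = 2 * (2 / c * srho z) := by ring
          linarith
        rw [hk, Set.indicator_of_mem hq, Set.indicator_of_mem hmem]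
        gcongr
        change (srho z ^ (m + 2))⁻¹ ≤ _
        rw [← div_eq_mul_inv, le_div_iff₀ (by positivity), ← div_eq_inv_mul,
          div_le_iff₀ (by positivity), ← mul_pow]
        gcongr
      · rw [hk, Set.indicator_of_notMem hq]
        exact zero_le
    calc ∫⁻ z in Siegel m, k (z, w) ∂μ
        ≤ ∫⁻ z in Siegel m, (sball w r).indicator (fun _ =>
            K * ENNReal.ofReal ((4 / c) ^ (m + 2) * (srho w ^ (m + 2))⁻¹) * F w) z ∂μ :=
          lintegral_mono hbound
      _ ≤ K * ENNReal.ofReal ((4 / c) ^ (m + 2) * (srho w ^ (m + 2))⁻¹) * F w *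
            μ (sball w r) :=
          (lintegral_indicator_const_le _ _).trans
            (mul_le_mul_right (Measure.restrict_apply_le _ _) _)
      _ ≤ K * ENNReal.ofReal ((4 / c) ^ (m + 2) * (srho w ^ (m + 2))⁻¹) * F w *
            ENNReal.ofReal (C * srho w ^ (m + 2)) := by gcongr; exact hμ w hw
      _ = K * (ENNReal.ofReal ((4 / c) ^ (m + 2) * (srho w ^ (m + 2))⁻¹) *
            ENNReal.ofReal (C * srho w ^ (m + 2))) * F w := by ring
      _ = _ := by
          rw [← ENNReal.ofReal_mul (by positivity)]
          congr 3
          field_simp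
  calc ∫⁻ z in Siegel m, ENNReal.ofReal (‖f z‖ ^ p) ∂μ
      ≤ ∫⁻ z in Siegel m, (∫⁻ w, k (z, w)) ∂μ := setLIntegral_mono' hSm hpoint
    _ = ∫⁻ w, ∫⁻ z in Siegel m, k (z, w) ∂μ :=
        lintegral_lintegral_swap (f := fun z w => k (z, w)) hkm.aemeasurable
    _ ≤ ∫⁻ w, K * ENNReal.ofReal ((4 / c) ^ (m + 2) * C) * F w := lintegral_mono hinner
    _ = K * ENNReal.ofReal ((4 / c) ^ (m + 2) * C) *
          ∫⁻ z in Siegel m, ENNReal.ofReal (‖f z‖ ^ p) := by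
        rw [lintegral_const_mul _ hFm, hF, lintegral_indicator hSm]
    _ ≤ _ := by
        gcongr
        conv_lhs => rw [← ENNReal.ofReal_toReal hK]
        rw [← ENNReal.ofReal_mul ENNReal.toReal_nonneg]
        exact ENNReal.ofReal_le_ofReal (by linarith)

end Carleson

section KernelIntegral

variable {m : ℕ}

lemma integrable_inv_one_add_re_sq_mul_im_sq :
    Integrable fun w : ℂ => (1 + w.re ^ 2)⁻¹ * (1 + w.im ^ 2)⁻¹ := by
  have h := integrable_inv_one_add_sq.mul_prod integrable_inv_one_add_sq
  exact Complex.volume_preserving_equiv_real_prod.integrable_comp_of_integrable h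

/-- A positive power of the Cayley-type factor `1 - (i/2) uₙ` dominates an integrable product. -/
lemma inv_norm_pow_le {u : SPoint m} (hu : ∑ j, ‖u.1 j‖ ^ 2 < 1 + u.2.im) :
    (‖1 - Complex.I / 2 * u.2‖ ^ (2 * (m + 2)))⁻¹ ≤ 4 ^ (m + 2) *
      ((∏ j, (1 + (u.1 j).re ^ 2)⁻¹ * (1 + (u.1 j).im ^ 2)⁻¹) *
        ((1 + (u.2 + Complex.I).re ^ 2)⁻¹ * (1 + (u.2 + Complex.I).im ^ 2)⁻¹)) := by
  set A := (2 + u.2.im) ^ 2 + u.2.re ^ 2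
  have hnorm : ‖1 - Complex.I / 2 * u.2‖ ^ 2 = A / 4 := by
    rw [Complex.sq_norm, Complex.normSq_apply]
    simp
    ring
  have hnonneg : ∀ j ∈ Finset.univ, 0 ≤ ‖u.1 j‖ ^ 2 := fun _ _ => by positivity
  have hy : 0 < 1 + u.2.im := (Finset.sum_nonneg hnonneg).trans_lt hu
  have hfst : ∏ j, (1 + (u.1 j).re ^ 2) * (1 + (u.1 j).im ^ 2) ≤ A ^ m := by
    calc ∏ j, (1 + (u.1 j).re ^ 2) * (1 + (u.1 j).im ^ 2) ≤ ∏ _j : Fin m, A := by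
          refine Finset.prod_le_prod (fun _ _ => by positivity) fun j hj => ?_
          have h1 := Finset.single_le_sum hnonneg hj
          have h2 : ‖u.1 j‖ ^ 2 = (u.1 j).re ^ 2 + (u.1 j).im ^ 2 := by
            rw [Complex.sq_norm, Complex.normSq_apply]; ring
          have h3 : 1 + ‖u.1 j‖ ^ 2 ≤ 2 + u.2.im := by linarith
          have h4 : (1 + ‖u.1 j‖ ^ 2) ^ 2 ≤ (2 + u.2.im) ^ 2 := by gcongr
          rw [h2] at h4
          nlinarith [sq_nonneg ((u.1 j).re * (u.1 j).im), sq_nonneg (u.1 j).re,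
            sq_nonneg (u.1 j).im, sq_nonneg u.2.re]
      _ = A ^ m := by simp
  have hsnd : (1 + (u.2 + Complex.I).re ^ 2) * (1 + (u.2 + Complex.I).im ^ 2) ≤ A ^ 2 := by
    rw [sq A]
    simp only [Complex.add_re, Complex.I_re, Complex.add_im, Complex.I_im, add_zero]
    refine mul_le_mul ?_ ?_ (by positivity) (by positivity) <;>
      nlinarith [sq_nonneg u.2.re]
  rw [pow_mul, hnorm, div_pow, inv_div, div_eq_mul_inv, Finset.prod_mul_distrib,
    Finset.prod_inv_distrib, Finset.prod_inv_distrib, ← mul_inv, ← mul_inv, ← mul_inv,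
    ← Finset.prod_mul_distrib, pow_add A]
  gcongr

/-- The basic integral estimate for powers of `ρ(z,a)`. -/
lemma exists_lintegral_norm_srho2_le (m : ℕ) : ∃ K : ℝ, 0 < K ∧ ∀ a ∈ Siegel m,
    ∫⁻ z in Siegel m, ENNReal.ofReal ((‖srho2 z a‖ ^ (2 * (m + 2)))⁻¹) ≤
      ENNReal.ofReal (K / srho a ^ (m + 2)) := by
  set φ : ℂ → ℝ := fun w => (1 + w.re ^ 2)⁻¹ * (1 + w.im ^ 2)⁻¹
  set Φ : SPoint m → ℝ := fun u =>
    4 ^ (m + 2) * ((∏ j, φ (u.1 j)) * φ (u.2 + Complex.I))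
  have hint : Integrable Φ := by
    refine Integrable.const_mul ?_ _
    exact (Integrable.fintype_prod (f := fun (_ : Fin m) w => φ w) fun _ =>
      integrable_inv_one_add_re_sq_mul_im_sq).mul_prod
        (integrable_inv_one_add_re_sq_mul_im_sq.comp_add_right Complex.I)
  have hΦ0 : ∀ u, 0 ≤ Φ u := fun u => by
    have : ∀ w, 0 ≤ φ w := fun w => by positivity
    have := Finset.prod_nonneg fun j (_ : j ∈ Finset.univ) => this (u.1 j)
    positivity
  have hK0 : 0 ≤ ∫ u, Φ u := integral_nonneg hΦ0
  refine ⟨(∫ u, Φ u) + 1, by linarith, fun a ha => ?_⟩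
  have ha' : 0 < srho a := ha
  have hSm : MeasurableSet (Siegel m) := isOpen_siegel.measurableSet
  set F := (Siegel m).indicator fun z => ENNReal.ofReal ((‖srho2 z a‖ ^ (2 * (m + 2)))⁻¹) with hF
  have hFm : Measurable F := by
    have := (srho2_differentiable a).continuous.measurable
    exact Measurable.indicator (by fun_prop) hSm
  have hcov : ∫⁻ u, F (siegelChart a 1 u) = _ :=
    lintegral_comp_triangular hFm a.1
      (L := fun x => a.2 + 2 * Complex.I *
        ∑ j, ((√(srho a) * 1 : ℝ) : ℂ) * x j * (starRingEnd ℂ) (a.1 j))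
      (by fun_prop) (s := √(srho a) * 1) (t := srho a * 1) (by positivity) (by positivity)
  have hconst : ((√(srho a) * 1) ^ (2 * m))⁻¹ * ((srho a * 1) ^ 2)⁻¹ =
      (srho a ^ (m + 2))⁻¹ := by
    rw [mul_one, mul_one, pow_mul, Real.sq_sqrt ha'.le, ← mul_inv, pow_add]
  rw [hconst] at hcov
  have hpoint : ∀ u, F (siegelChart a 1 u) ≤
      ENNReal.ofReal ((srho a ^ (2 * (m + 2)))⁻¹) * ENNReal.ofReal (Φ u) := by
    intro u
    by_cases hu : siegelChart a 1 u ∈ Siegel m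
    · have hu' : 0 < srho (siegelChart a 1 u) := hu
      rw [srho_siegelChart ha', mul_pos_iff_of_pos_left ha'] at hu'
      rw [hF, Set.indicator_of_mem hu, ← ENNReal.ofReal_mul (by positivity), srho2_siegelChart,
        norm_mul, mul_pow, mul_inv, Complex.norm_real, Real.norm_of_nonneg ha'.le,
        Complex.ofReal_one, mul_one]
      gcongr
      exact inv_norm_pow_le (by linarith)
    · rw [hF, Set.indicator_of_notMem hu]
      exact zero_le
  have hle := lintegral_mono (μ := volume) hpoint
  rw [hcov, lintegral_const_mul' _ _ ENNReal.ofReal_ne_top,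
    ← ofReal_integral_eq_lintegral_ofReal hint (ae_of_all _ hΦ0),
    ← ENNReal.ofReal_mul (by positivity), hF, lintegral_indicator hSm] at hle
  have hmul := mul_le_mul_right hle (ENNReal.ofReal (srho a ^ (m + 2)))
  rw [← mul_assoc, ← ENNReal.ofReal_mul (by positivity), mul_inv_cancel₀ (by positivity),
    ENNReal.ofReal_one, one_mul, ← ENNReal.ofReal_mul (by positivity)] at hmul
  refine hmul.trans (ENNReal.ofReal_le_ofReal ?_)
  have : srho a ^ (m + 2) * ((srho a ^ (2 * (m + 2)))⁻¹ * ∫ u, Φ u) =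
      (∫ u, Φ u) / srho a ^ (m + 2) := by
    rw [two_mul, pow_add _ (m + 2)]
    field_simp
  rw [this]
  gcongr
  linarith

/-- The Carleson embedding, tested on powers of `ρ(·,a)`, gives the Berezin-type bound. -/
lemma berezin_of_carleson {p : ℝ} (hp : 0 < p) {μ : Measure (SPoint m)} {C : ℝ} (hC : 0 < C)
    (h : ∀ f : SPoint m → ℂ, MemAp (m + 1) p f →
      ∫⁻ z in Siegel m, ENNReal.ofReal (‖f z‖ ^ p) ∂μ ≤
        ENNReal.ofReal C * ∫⁻ z in Siegel m, ENNReal.ofReal (‖f z‖ ^ p)) :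
    ∃ C : ℝ, 0 < C ∧ ∀ a ∈ Siegel m,
      ∫⁻ z in Siegel m,
          ENNReal.ofReal (srho a ^ (m + 2) / ‖srho2 z a‖ ^ (2 * (m + 2))) ∂μ ≤
        ENNReal.ofReal C := by
  obtain ⟨K, hK, hKle⟩ := exists_lintegral_norm_srho2_le m
  refine ⟨C * K, by positivity, fun a ha => ?_⟩
  have ha' : 0 < srho a := ha
  have hSm : MeasurableSet (Siegel m) := isOpen_siegel.measurableSet
  set s : ℝ := -((2 * (m + 2) : ℕ) / p) with hs
  set f : SPoint m → ℂ := fun z => srho2 z a ^ (s : ℂ) with hf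
  have hslit : ∀ z ∈ Siegel m, srho2 z a ∈ Complex.slitPlane := by
    intro z hz
    have hz' : 0 < srho z := hz
    have : 0 ≤ ∑ j, ‖z.1 j - a.1 j‖ ^ 2 := Finset.sum_nonneg fun _ _ => by positivity
    exact Or.inl (by rw [srho2_re]; linarith)
  have hdiff : DifferentiableOn ℂ f (Siegel m) := fun z hz =>
    ((srho2_differentiable a z).cpow_const (hslit z hz)).differentiableWithinAt
  have hnorm : ∀ z ∈ Siegel m, ‖f z‖ ^ p = (‖srho2 z a‖ ^ (2 * (m + 2)))⁻¹ := by
    intro z hz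
    have hpos := norm_srho2_pos hz ha'
    rw [hf, Complex.norm_cpow_real, ← Real.rpow_mul hpos.le, hs, neg_mul,
      div_mul_cancel₀ _ hp.ne', Real.rpow_neg hpos.le, Real.rpow_natCast]
  have hlint : ∀ ν : Measure (SPoint m), ∫⁻ z in Siegel m, ENNReal.ofReal (‖f z‖ ^ p) ∂ν =
      ∫⁻ z in Siegel m, ENNReal.ofReal ((‖srho2 z a‖ ^ (2 * (m + 2)))⁻¹) ∂ν := fun ν =>
    setLIntegral_congr_fun hSm fun z hz => by simp only [hnorm z hz]
  have hmem : MemAp (m + 1) p f := by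
    refine ⟨hdiff, ?_, ?_⟩
    · exact (hdiff.continuousOn.norm.rpow_const fun _ _ => Or.inr hp.le).aestronglyMeasurable hSm
    · rw [hasFiniteIntegral_iff_ofReal (ae_of_all _ fun z => by positivity)]
      exact (hlint volume).trans_lt ((hKle a ha).trans_lt ENNReal.ofReal_lt_top)
  have hle := h f hmem
  rw [hlint, hlint] at hle
  have hmul : ∀ z, ENNReal.ofReal (srho a ^ (m + 2) / ‖srho2 z a‖ ^ (2 * (m + 2))) =
      ENNReal.ofReal (srho a ^ (m + 2)) *
        ENNReal.ofReal ((‖srho2 z a‖ ^ (2 * (m + 2)))⁻¹) := fun z => by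
    rw [div_eq_mul_inv, ENNReal.ofReal_mul (by positivity)]
  simp_rw [hmul]
  rw [lintegral_const_mul' _ _ ENNReal.ofReal_ne_top]
  calc _ ≤ ENNReal.ofReal (srho a ^ (m + 2)) *
        (ENNReal.ofReal C * ENNReal.ofReal (K / srho a ^ (m + 2))) := by
        gcongr
        exact hle.trans (mul_le_mul_right (hKle a ha) _)
    _ = ENNReal.ofReal (C * K) := by
        rw [← ENNReal.ofReal_mul hC.le, ← ENNReal.ofReal_mul (by positivity)]
        congr 1
        field_simp

/-- The Berezin-type bound controls the measure of Bergman balls. -/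
lemma ball_of_berezin {r : ℝ} (hr : 0 < r) {μ : Measure (SPoint m)} {C : ℝ} (hC : 0 < C)
    (h : ∀ a ∈ Siegel m,
      ∫⁻ z in Siegel m,
          ENNReal.ofReal (srho a ^ (m + 2) / ‖srho2 z a‖ ^ (2 * (m + 2))) ∂μ ≤
        ENNReal.ofReal C) :
    ∃ C : ℝ, 0 < C ∧ ∀ a ∈ Siegel m, μ (sball a r) ≤ ENNReal.ofReal (C * srho a ^ (m + 2)) := by
  obtain ⟨c, hc, -, hball⟩ := exists_sbeta_lt_iff hr
  refine ⟨(2 / c) ^ (2 * (m + 2)) * C, by positivity, fun a ha => ?_⟩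
  have ha' : 0 < srho a := ha
  set M := (2 / c) ^ (2 * (m + 2)) * srho a ^ (m + 2) with hM
  have hM0 : 0 < M := by positivity
  have hpoint : ∀ z ∈ sball a r,
      1 ≤ ENNReal.ofReal M *
        ENNReal.ofReal (srho a ^ (m + 2) / ‖srho2 z a‖ ^ (2 * (m + 2))) := by
    intro z hz
    have hz' : 0 < srho z := hz.1
    have hlt := (hball ha' hz').1 hz.2
    rw [norm_srho2_comm, mul_comm (srho a)] at hlt
    have hle := norm_srho2_le hc hz' ha' hlt
    have hpos := norm_srho2_pos hz' ha'
    rw [← ENNReal.ofReal_mul hM0.le, ENNReal.one_le_ofReal, hM, mul_div_assoc', le_div_iff₀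
      (by positivity), one_mul]
    calc ‖srho2 z a‖ ^ (2 * (m + 2)) ≤ (2 / c * srho a) ^ (2 * (m + 2)) := by gcongr
      _ = _ := by ring
  have hopen : sball a r = {w | 0 < srho w ∧ c * ‖srho2 a w‖ ^ 2 < srho a * srho w} :=
    Set.ext fun w => and_congr_right fun hw => hball ha' hw
  have hmeas : MeasurableSet (sball a r) := by
    rw [hopen]; exact (isOpen_bergman_section c a).measurableSet
  calc μ (sball a r) = ∫⁻ _ in sball a r, 1 ∂μ := (setLIntegral_one _).symm
    _ ≤ ∫⁻ z in sball a r, ENNReal.ofReal M *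
          ENNReal.ofReal (srho a ^ (m + 2) / ‖srho2 z a‖ ^ (2 * (m + 2))) ∂μ :=
        setLIntegral_mono' hmeas hpoint
    _ ≤ ∫⁻ z in Siegel m, ENNReal.ofReal M *
          ENNReal.ofReal (srho a ^ (m + 2) / ‖srho2 z a‖ ^ (2 * (m + 2))) ∂μ :=
        lintegral_mono_set fun z hz => hz.1
    _ ≤ ENNReal.ofReal M * ENNReal.ofReal C := by
        rw [lintegral_const_mul' _ _ ENNReal.ofReal_ne_top]
        exact mul_le_mul_right (h a ha) _
    _ = _ := by
        rw [← ENNReal.ofReal_mul hM0.le, hM]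
        congr 1
        ring

end KernelIntegral

/-- for `0 < p < ∞`, `r > 0` and a positive Borel measure `μ`,
the Carleson property (a), the Berezin-type bound (b) and the ball bound (c)
are equivalent. -/
theorem carleson_characterization (n : ℕ) (hn : 1 ≤ n) (p : ℝ) (hp : 0 < p)
    (r : ℝ) (hr : 0 < r) (μ : Measure (SPoint (n - 1))) :
    ((∃ C : ℝ, 0 < C ∧ ∀ f : SPoint (n - 1) → ℂ, MemAp n p f →
        ∫⁻ z in Siegel (n - 1), ENNReal.ofReal (‖f z‖ ^ p) ∂μ ≤
          ENNReal.ofReal C *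
            ∫⁻ z in Siegel (n - 1), ENNReal.ofReal (‖f z‖ ^ p)) ↔
      (∃ C : ℝ, 0 < C ∧ ∀ a ∈ Siegel (n - 1),
        ∫⁻ z in Siegel (n - 1),
            ENNReal.ofReal (srho a ^ (n + 1) / ‖srho2 z a‖ ^ (2 * (n + 1))) ∂μ ≤
          ENNReal.ofReal C)) ∧
    ((∃ C : ℝ, 0 < C ∧ ∀ f : SPoint (n - 1) → ℂ, MemAp n p f →
        ∫⁻ z in Siegel (n - 1), ENNReal.ofReal (‖f z‖ ^ p) ∂μ ≤
          ENNReal.ofReal C *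
            ∫⁻ z in Siegel (n - 1), ENNReal.ofReal (‖f z‖ ^ p)) ↔
      (∃ C : ℝ, 0 < C ∧ ∀ a ∈ Siegel (n - 1),
        μ (sball a r) ≤ ENNReal.ofReal (C * srho a ^ (n + 1)))) := by
  obtain ⟨m, rfl⟩ : ∃ m, n = m + 1 := ⟨n - 1, by omega⟩
  refine ⟨⟨fun ⟨C, hC, h⟩ => berezin_of_carleson hp hC h, fun ⟨C, hC, h⟩ => ?_⟩,
    ⟨fun ⟨C, hC, h⟩ => ?_, fun ⟨C, hC, h⟩ => ?_⟩⟩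
  · obtain ⟨C', hC', h'⟩ := ball_of_berezin hr hC h
    obtain ⟨K, hK, hcar⟩ := carleson_of_ball hp hr hC' h'
    exact ⟨K, hK, fun f hf => hcar f hf.1⟩
  · obtain ⟨C', hC', h'⟩ := berezin_of_carleson hp hC h
    exact ball_of_berezin hr hC' h'
  · obtain ⟨K, hK, hcar⟩ := carleson_of_ball hp hr hC h
    exact ⟨K, hK, fun f hf => hcar f hf.1⟩
end

section
/- If 1 ≤ p < ∞ and α > n + 1/p, then 𝒮_α is contained in Aᵖ(𝒰) and is dense in Aᵖ(𝒰): for every f ∈ Aᵖ(𝒰) and every ε > 0 there exists g ∈ 𝒮_α with ∫_𝒰 |f − g|ᵖ dV < εᵖ. -/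
open MeasureTheory Filter

instance isAddHaarMeasure_volume_SPoint (m : ℕ) :
    (volume : Measure (SPoint m)).IsAddHaarMeasure :=
  Measure.prod.instIsAddHaarMeasure _ _

theorem isOpen_Siegel (m : ℕ) : IsOpen (Siegel m) := by
  refine isOpen_lt continuous_const ?_
  unfold srho
  fun_prop

theorem srho_add_I_mul {m : ℕ} (z : SPoint m) (t : ℝ) :
    srho (z + (0, (t : ℂ) * Complex.I)) = srho z + t := by
  simp [srho]
  ring

theorem norm_sq_lt_im {m : ℕ} {z : SPoint m} (hz : z ∈ Siegel m) (j : Fin m) :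
    ‖z.1 j‖ ^ 2 < z.2.im := by
  have h : ∑ j, ‖z.1 j‖ ^ 2 < z.2.im := sub_pos.1 hz
  exact (Finset.single_le_sum (f := fun j => ‖z.1 j‖ ^ 2) (fun i _ => by positivity)
    (Finset.mem_univ j)).trans_lt h

theorem im_pos_of_mem_Siegel {m : ℕ} {z : SPoint m} (hz : z ∈ Siegel m) : 0 < z.2.im := by
  have h : ∑ j, ‖z.1 j‖ ^ 2 < z.2.im := sub_pos.1 hz
  exact (Finset.sum_nonneg fun i _ => by positivity).trans_lt h

theorem im_add_one_le_norm_add_I (w : ℂ) : w.im + 1 ≤ ‖w + Complex.I‖ := by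
  simpa using (le_abs_self _).trans (Complex.abs_im_le_norm (w + Complex.I))

theorem one_add_norm_le_two_mul {w : ℂ} (hw : 0 ≤ w.im) : 1 + ‖w‖ ≤ 2 * ‖w + Complex.I‖ := by
  have h1 := im_add_one_le_norm_add_I w
  have h2 : ‖w‖ ≤ ‖w + Complex.I‖ := by
    rw [Complex.norm_def, Complex.norm_def]
    apply Real.sqrt_le_sqrt
    simp [Complex.normSq_apply]
    nlinarith
  linarith

/-- Multiplication by a unimodular scalar preserves Lebesgue measure on `ℂⁿ`. -/
theorem measurePreserving_smul_of_norm_eq_one {m : ℕ} {c : ℂ} (hc : ‖c‖ = 1) :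
    MeasurePreserving (fun z : SPoint m => c • z) := by
  have h1 : MeasurePreserving (fun z : ℂ => c • z) := by
    have := (rotation ⟨c, by simpa [Submonoid.unitSphere] using hc⟩).measurePreserving
    exact this
  exact (volume_preserving_pi (fun _ : Fin m => h1)).prod h1

/-- The mean value inequality for holomorphic functions on polydiscs. -/
theorem enorm_mul_volume_closedBall_le {m : ℕ} {f : SPoint m → ℂ} {U : Set (SPoint m)}
    (hU : IsOpen U) (hf : DifferentiableOn ℂ f U) {w : SPoint m} {r : ℝ}
    (hr : Metric.closedBall w r ⊆ U) :
    ‖f w‖ₑ * volume (Metric.closedBall w r) ≤ ∫⁻ z in Metric.closedBall w r, ‖f z‖ₑ := by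
  classical
  set F : SPoint m → ENNReal := (Metric.closedBall w r).indicator (fun z => ‖f z‖ₑ) with hF
  have hFm : Measurable F := by
    have := (hf.continuousOn.mono hr).enorm.measurable_piecewise
      (g := fun _ => (0 : ENNReal)) continuousOn_const Metric.isClosed_closedBall.measurableSet
    rw [hF, ← Set.piecewise_eq_indicator]
    exact this
  have circ : ∀ h ∈ Metric.closedBall (0 : SPoint m) r,
      ENNReal.ofReal (2 * Real.pi) * ‖f w‖ₑ ≤
        ∫⁻ θ in Set.Ioc 0 (2 * Real.pi), F (w + circleMap 0 1 θ • h) := by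
    intro h hh
    rw [mem_closedBall_zero_iff] at hh
    have hmem : ∀ c : ℂ, ‖c‖ ≤ 1 → w + c • h ∈ Metric.closedBall w r := by
      intro c hc
      rw [Metric.mem_closedBall, dist_self_add_left, norm_smul]
      nlinarith [norm_nonneg h, norm_nonneg c]
    have hline : ∀ c : ℂ, ‖c‖ ≤ 1 → DifferentiableAt ℂ (fun c : ℂ => f (w + c • h)) c := by
      intro c hc
      exact ((hf _ (hr (hmem c hc))).differentiableAt (hU.mem_nhds (hr (hmem c hc)))).comp c
        (by fun_prop)
    have hmv := circleAverage_of_differentiable_on_off_countable (f := fun c : ℂ => f (w + c • h))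
      (c := 0) (R := 1) Set.countable_empty
      (fun c hc => (hline c (by simpa using hc)).continuousAt.continuousWithinAt)
      (fun c hc => hline c (by simpa using (Metric.mem_ball.1 hc.1).le))
    rw [Real.circleAverage_def, zero_smul, add_zero,
      intervalIntegral.integral_of_le Real.two_pi_pos.le] at hmv
    have hint : (∫ θ in Set.Ioc 0 (2 * Real.pi), f (w + circleMap 0 1 θ • h)) =
        (2 * Real.pi) • f w := by
      rw [← hmv, smul_inv_smul₀ Real.two_pi_pos.ne']
    calc ENNReal.ofReal (2 * Real.pi) * ‖f w‖ₑ
        = ‖(2 * Real.pi) • f w‖ₑ := by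
          rw [enorm_smul, Real.enorm_of_nonneg Real.two_pi_pos.le]
      _ ≤ ∫⁻ θ in Set.Ioc 0 (2 * Real.pi), ‖f (w + circleMap 0 1 θ • h)‖ₑ := by
          rw [← hint]; exact enorm_integral_le_lintegral_enorm _
      _ = _ := by
          refine lintegral_congr fun θ => ?_
          rw [hF, Set.indicator_of_mem (hmem _ (by simp))]
  have hpi : ENNReal.ofReal (2 * Real.pi) ≠ 0 := by simp [Real.pi_pos]
  rw [← ENNReal.mul_le_mul_iff_right hpi ENNReal.ofReal_ne_top]
  calc ENNReal.ofReal (2 * Real.pi) * (‖f w‖ₑ * volume (Metric.closedBall w r))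
      = ∫⁻ _ in Metric.closedBall (0 : SPoint m) r, ENNReal.ofReal (2 * Real.pi) * ‖f w‖ₑ := by
        rw [setLIntegral_const, mul_assoc, Measure.addHaar_closedBall_center volume w]
    _ ≤ ∫⁻ h in Metric.closedBall (0 : SPoint m) r,
          ∫⁻ θ in Set.Ioc 0 (2 * Real.pi), F (w + circleMap 0 1 θ • h) :=
        setLIntegral_mono' Metric.isClosed_closedBall.measurableSet circ
    _ ≤ ∫⁻ h : SPoint m, ∫⁻ θ in Set.Ioc 0 (2 * Real.pi), F (w + circleMap 0 1 θ • h) :=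
        setLIntegral_le_lintegral _ _
    _ = ∫⁻ θ in Set.Ioc 0 (2 * Real.pi), ∫⁻ h : SPoint m, F (w + circleMap 0 1 θ • h) := by
        refine lintegral_lintegral_swap (hFm.comp ?_).aemeasurable
        refine Continuous.measurable ?_
        have := continuous_circleMap 0 1
        exact continuous_const.add ((this.comp continuous_snd).smul continuous_fst)
    _ = ∫⁻ θ in Set.Ioc 0 (2 * Real.pi), ∫⁻ h : SPoint m, F h := by
        refine lintegral_congr fun θ => ?_
        rw [(measurePreserving_smul_of_norm_eq_one (m := m) (c := circleMap 0 1 θ)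
          (by simp)).lintegral_comp (f := fun h => F (w + h)) (hFm.comp (measurable_const_add w)),
          lintegral_add_left_eq_self]
    _ = _ := by
        rw [setLIntegral_const, mul_comm, hF,
          lintegral_indicator Metric.isClosed_closedBall.measurableSet]
        simp

/-- If `g k → f` almost everywhere and `∫ |g k|ᵖ ≤ ∫ |f|ᵖ < ∞`, then `g k → f` in `Lᵖ`. -/
theorem eventually_lintegral_norm_sub_rpow_lt {X : Type*} [MeasurableSpace X] {μ : Measure X}
    {p : ℝ} (hp : 1 ≤ p) {f : X → ℂ} {g : ℕ → X → ℂ}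
    (hf : AEStronglyMeasurable f μ) (hg : ∀ k, AEStronglyMeasurable (g k) μ)
    (hfin : ∫⁻ x, ‖f x‖ₑ ^ p ∂μ ≠ ⊤)
    (hle : ∀ k, ∫⁻ x, ‖g k x‖ₑ ^ p ∂μ ≤ ∫⁻ x, ‖f x‖ₑ ^ p ∂μ)
    (hlim : ∀ᵐ x ∂μ, Tendsto (fun k => g k x) atTop (nhds (f x)))
    {η : ENNReal} (hη : 0 < η) :
    ∀ᶠ k in atTop, ∫⁻ x, ‖f x - g k x‖ₑ ^ p ∂μ < η := by
  have hp0 : 0 < p := one_pos.trans_le hp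
  set C : ENNReal := 2 ^ p with hC
  have hCtop : C ≠ ⊤ := ENNReal.rpow_ne_top_of_nonneg hp0.le (by simp)
  set a : ℕ → X → ENNReal := fun k x => ‖f x - g k x‖ₑ ^ p with ha
  set s : ℕ → X → ENNReal := fun k x => C * (‖f x‖ₑ ^ p + ‖g k x‖ₑ ^ p) with hs
  have has : ∀ k x, a k x ≤ s k x := fun k x =>
    (ENNReal.rpow_le_rpow enorm_sub_le hp0.le).trans
      (ENNReal.add_rpow_le_two_rpow_mul_rpow_add_rpow _ _ hp0.le)
  have ham : ∀ k, AEMeasurable (a k) μ := fun k => (hf.sub (hg k)).enorm.pow_const p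
  have hsm : ∀ k, AEMeasurable (s k) μ := fun k =>
    ((hf.enorm.pow_const p).add ((hg k).enorm.pow_const p)).const_mul C
  set I := ∫⁻ x, ‖f x‖ₑ ^ p ∂μ with hI
  have hsI : ∀ k, ∫⁻ x, s k x ∂μ ≤ C * (I + I) := by
    intro k
    rw [lintegral_const_mul' _ _ hCtop, lintegral_add_left' (hf.enorm.pow_const p)]
    gcongr
    exact hle k
  have hsum : ∀ k, ∫⁻ x, a k x ∂μ + ∫⁻ x, (s k x - a k x) ∂μ ≤ C * (I + I) := by
    intro k
    rw [← lintegral_add_left' (ham k)]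
    simpa only [add_tsub_cancel_of_le (has k _)] using hsI k
  have hfatou : C * (I + I) ≤ liminf (fun k => ∫⁻ x, (s k x - a k x) ∂μ) atTop := by
    refine le_trans (le_of_eq ?_) (lintegral_liminf_le' fun k => (hsm k).sub (ham k))
    rw [hI, ← lintegral_add_left' (hf.enorm.pow_const p), ← lintegral_const_mul' _ _ hCtop]
    refine lintegral_congr_ae ?_
    filter_upwards [hlim] with x hx
    have h1 : Tendsto (fun k => a k x) atTop (nhds 0) := by
      have := ((tendsto_const_nhds (x := f x)).sub hx).enorm.ennrpow_const p
      simpa [hp0] using this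
    have h2 : Tendsto (fun k => s k x) atTop (nhds (C * (‖f x‖ₑ ^ p + ‖f x‖ₑ ^ p))) := by
      refine ENNReal.Tendsto.const_mul ?_ (Or.inr hCtop)
      exact tendsto_const_nhds.add (hx.enorm.ennrpow_const p)
    have h3 := ENNReal.Tendsto.sub h2 h1 (Or.inr ENNReal.zero_ne_top)
    rw [tsub_zero] at h3
    exact h3.liminf_eq.symm
  have hLtop : C * (I + I) ≠ ⊤ := ENNReal.mul_ne_top hCtop (ENNReal.add_ne_top.2 ⟨hfin, hfin⟩)
  rcases eq_or_ne (C * (I + I)) 0 with h0 | h0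
  · refine Eventually.of_forall fun k => ?_
    have := hsum k
    rw [h0, nonpos_iff_eq_zero, add_eq_zero] at this
    exact this.1.trans_lt hη
  · have hev : ∀ᶠ k in atTop, C * (I + I) - η < ∫⁻ x, (s k x - a k x) ∂μ :=
      eventually_lt_of_lt_liminf ((ENNReal.sub_lt_self hLtop h0 hη.ne').trans_le hfatou)
    filter_upwards [hev] with k hk
    have hbtop : ∫⁻ x, (s k x - a k x) ∂μ ≠ ⊤ :=
      ne_top_of_le_ne_top hLtop (le_add_self.trans (hsum k))
    have hlt : C * (I + I) < ∫⁻ x, (s k x - a k x) ∂μ + η := by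
      by_cases hηt : η = ⊤
      · simp [hηt, hLtop.lt_top]
      · exact ENNReal.lt_add_of_sub_lt_right (Or.inr hηt) hk
    have := (hsum k).trans_lt hlt
    rw [add_comm] at this
    exact (ENNReal.add_lt_add_iff_left hbtop).1 this

theorem lintegral_Siegel_norm_add_I_rpow_lt_top {m : ℕ} {s : ℝ} (hs : (m : ℝ) + 2 < s) :
    ∫⁻ z in Siegel m, ENNReal.ofReal (‖z.2 + Complex.I‖ ^ (-s)) < ⊤ := by
  have hmeas : Measurable fun z : SPoint m => ENNReal.ofReal (‖z.2 + Complex.I‖ ^ (-s)) := by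
    fun_prop
  have hU := (isOpen_Siegel m).measurableSet
  set κ := volume (Metric.ball (0 : Fin m → ℂ) 1) with hκ
  have hκtop : κ ≠ ⊤ := measure_ball_lt_top.ne
  rw [← lintegral_indicator hU, Measure.volume_eq_prod,
    lintegral_prod_symm' _ (hmeas.indicator hU)]
  have key : ∀ y : ℂ, (∫⁻ x : Fin m → ℂ, (Siegel m).indicator
      (fun z => ENNReal.ofReal (‖z.2 + Complex.I‖ ^ (-s))) (x, y)) ≤
      κ * ENNReal.ofReal (2 ^ (s - m) * (1 + ‖y‖) ^ (-(s - m))) := by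
    intro y
    rcases le_or_gt y.im 0 with hy | hy
    · have : ∀ x : Fin m → ℂ, (Siegel m).indicator
          (fun z => ENNReal.ofReal (‖z.2 + Complex.I‖ ^ (-s))) (x, y) = 0 := fun x =>
        Set.indicator_of_notMem (fun h => (im_pos_of_mem_Siegel h).not_ge hy) _
      simp [this]
    set A := ‖y + Complex.I‖ with hA
    have hyA := im_add_one_le_norm_add_I y
    have hA0 : 0 < A := by linarith
    have hle : ∀ x : Fin m → ℂ, (Siegel m).indicator
        (fun z => ENNReal.ofReal (‖z.2 + Complex.I‖ ^ (-s))) (x, y) ≤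
        (Metric.closedBall (0 : Fin m → ℂ) (√A)).indicator
          (fun _ => ENNReal.ofReal (A ^ (-s))) x := by
      intro x
      by_cases hx : (x, y) ∈ Siegel m
      · rw [Set.indicator_of_mem hx, Set.indicator_of_mem]
        rw [mem_closedBall_zero_iff, pi_norm_le_iff_of_nonneg (Real.sqrt_nonneg _)]
        intro j
        apply Real.le_sqrt_of_sq_le
        have := norm_sq_lt_im hx j
        simp only at this
        linarith
      · rw [Set.indicator_of_notMem hx]
        exact zero_le
    refine (lintegral_mono hle).trans ?_
    rw [lintegral_indicator Metric.isClosed_closedBall.measurableSet, setLIntegral_const,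
      Measure.addHaar_closedBall _ _ (Real.sqrt_nonneg _), ← mul_assoc, mul_comm, hκ]
    gcongr
    rw [← ENNReal.ofReal_mul (by positivity)]
    apply ENNReal.ofReal_le_ofReal
    have hdim : Module.finrank ℝ (Fin m → ℂ) = 2 * m := by
      simp [Module.finrank_pi_fintype, Complex.finrank_real_complex, mul_comm]
    rw [hdim, pow_mul, Real.sq_sqrt hA0.le, ← Real.rpow_natCast, ← Real.rpow_add hA0]
    have h2 : (1 + ‖y‖) / 2 ≤ A := by
      have := one_add_norm_le_two_mul hy.le
      linarith
    calc A ^ (-s + m) = A ^ (-(s - m)) := by ring_nf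
      _ ≤ ((1 + ‖y‖) / 2) ^ (-(s - m)) :=
          Real.rpow_le_rpow_of_nonpos (by positivity) h2 (by linarith)
      _ = _ := by
          rw [Real.div_rpow (by positivity) (by norm_num), Real.rpow_neg (by norm_num : (0:ℝ) ≤ 2),
            div_inv_eq_mul, mul_comm]
  refine (lintegral_mono key).trans_lt ?_
  rw [lintegral_const_mul' _ _ hκtop]
  refine ENNReal.mul_lt_top hκtop.lt_top ?_
  refine Integrable.lintegral_lt_top (Integrable.const_mul (integrable_one_add_norm ?_) _)
  rw [Complex.finrank_real_complex]
  push_cast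
  linarith

theorem MemAp_of_SAlpha {n : ℕ} (hn : 1 ≤ n) {p : ℝ} (hp : 1 ≤ p) {α : ℝ}
    (hα : (n : ℝ) + 1 / p < α) {f : SPoint (n - 1) → ℂ} (hf : SAlpha n α f) : MemAp n p f := by
  obtain ⟨hd, M, hM⟩ := hf
  have hp0 : 0 < p := one_pos.trans_le hp
  have hU := (isOpen_Siegel (n - 1)).measurableSet
  refine ⟨hd, ?_⟩
  have hs : ((n - 1 : ℕ) : ℝ) + 2 < α * p := by
    have h1 := mul_lt_mul_of_pos_right hα hp0
    rw [add_mul, one_div, inv_mul_cancel₀ hp0.ne'] at h1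
    have hn' : (1 : ℝ) ≤ n := by exact_mod_cast hn
    push_cast [hn]
    nlinarith
  have hdom : IntegrableOn (fun z : SPoint (n - 1) => M ^ p * ‖z.2 + Complex.I‖ ^ (-(α * p)))
      (Siegel (n - 1)) := by
    refine Integrable.const_mul ⟨Measurable.aestronglyMeasurable (by fun_prop), ?_⟩ _
    rw [hasFiniteIntegral_iff_ofReal (Eventually.of_forall fun z => by positivity)]
    exact lintegral_Siegel_norm_add_I_rpow_lt_top hs
  refine hdom.mono' ((hd.continuousOn.norm.rpow_const
    (fun _ _ => Or.inr hp0.le)).aestronglyMeasurable hU) ?_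
  filter_upwards [ae_restrict_mem hU] with z hz
  have hA : 0 < ‖z.2 + Complex.I‖ := by
    linarith [im_add_one_le_norm_add_I z.2, im_pos_of_mem_Siegel hz]
  rw [Real.norm_of_nonneg (by positivity), Real.rpow_neg hA.le, ← div_eq_mul_inv,
    le_div_iff₀ (by positivity), Real.rpow_mul hA.le, mul_comm,
    ← Real.mul_rpow (by positivity) (by positivity)]
  exact Real.rpow_le_rpow (by positivity) (hM z hz) hp0.le

/-- Polydiscs of radius `t / ((2 + 3 m) |zₙ + i|)` about `z + (0, i t)` stay inside `𝒰`. -/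
theorem closedBall_subset_Siegel {m : ℕ} {z : SPoint m} (hz : z ∈ Siegel m) {t : ℝ} (ht : 0 < t)
    (ht1 : t ≤ 1) :
    Metric.closedBall (z + (0, (t : ℂ) * Complex.I)) (t / ((2 + 3 * m) * ‖z.2 + Complex.I‖)) ⊆
      Siegel m := by
  set A := ‖z.2 + Complex.I‖ with hA
  have him := im_pos_of_mem_Siegel hz
  have hAi : z.2.im + 1 ≤ A := im_add_one_le_norm_add_I z.2
  have hA1 : 1 ≤ A := by linarith
  set r := t / ((2 + 3 * m) * A) with hr
  have hr0 : 0 < r := by positivity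
  have hrA : r * ((2 + 3 * m) * A) = t := div_mul_cancel₀ _ (by positivity)
  have hr1 : r ≤ 1 := by
    refine (div_le_one (by positivity)).2 (ht1.trans ?_)
    nlinarith [(Nat.cast_nonneg m : (0 : ℝ) ≤ m)]
  intro w hw
  rw [Metric.mem_closedBall, dist_eq_norm] at hw
  have hw2 : z.2.im + t - r ≤ w.2.im := by
    have h1 := (norm_snd_le _).trans hw
    have h2 := (Complex.abs_im_le_norm _).trans h1
    have h3 := (abs_le.1 h2).1
    simp at h3
    linarith
  have hw1 : ∀ j, ‖w.1 j‖ ^ 2 ≤ ‖z.1 j‖ ^ 2 + 3 * r * A := by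
    intro j
    have h1 := (norm_le_pi_norm _ j).trans ((norm_fst_le _).trans hw)
    simp at h1
    have h2 : ‖w.1 j‖ ≤ ‖z.1 j‖ + r := by
      have := norm_sub_norm_le (w.1 j) (z.1 j)
      linarith
    have h3 : ‖z.1 j‖ ≤ A := by
      have := norm_sq_lt_im hz j
      nlinarith [norm_nonneg (z.1 j)]
    have h4 : ‖w.1 j‖ ^ 2 ≤ (‖z.1 j‖ + r) ^ 2 := by gcongr
    nlinarith [mul_le_mul_of_nonneg_left h3 hr0.le,
      mul_le_mul_of_nonneg_left (hr1.trans hA1) hr0.le]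
  have hsum : ∑ j, ‖w.1 j‖ ^ 2 ≤ ∑ j, ‖z.1 j‖ ^ 2 + m * (3 * r * A) := by
    refine (Finset.sum_le_sum fun j _ => hw1 j).trans (le_of_eq ?_)
    rw [Finset.sum_add_distrib]
    simp
  have hz0 : 0 < z.2.im - ∑ j, ‖z.1 j‖ ^ 2 := hz
  change 0 < w.2.im - ∑ j, ‖w.1 j‖ ^ 2
  nlinarith [mul_le_mul_of_nonneg_left hA1 hr0.le]

/-- Vertical translates of `Lᵖ` holomorphic functions on `𝒰` have polynomial growth. -/
theorem exists_norm_translate_le {m : ℕ} {p : ℝ} (hp : 1 ≤ p) {f : SPoint m → ℂ}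
    (hd : DifferentiableOn ℂ f (Siegel m)) (hint : IntegrableOn (fun z => ‖f z‖ ^ p) (Siegel m))
    {t : ℝ} (ht : 0 < t) (ht1 : t ≤ 1) :
    ∃ C : ℝ, ∀ z ∈ Siegel m,
      ‖f (z + (0, (t : ℂ) * Complex.I))‖ ≤
        C * ‖z.2 + Complex.I‖ ^ Module.finrank ℝ (SPoint m) := by
  set K := ∫⁻ z in Siegel m, ENNReal.ofReal (‖f z‖ ^ p) with hK
  have hKtop : K ≠ ⊤ := hint.lintegral_lt_top.ne
  set κ := volume (Metric.ball (0 : SPoint m) 1) with hκ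
  have hκtop : κ ≠ ⊤ := measure_ball_lt_top.ne
  have hκ0 : 0 < κ.toReal := ENNReal.toReal_pos (Metric.measure_ball_pos _ _ one_pos).ne' hκtop
  set d := Module.finrank ℝ (SPoint m) with hdim
  refine ⟨1 + K.toReal / (t / (2 + 3 * m)) ^ d / κ.toReal, fun z hz => ?_⟩
  set A := ‖z.2 + Complex.I‖ with hA
  have hA1 : 1 ≤ A := by
    linarith [im_add_one_le_norm_add_I z.2, im_pos_of_mem_Siegel hz]
  set w := z + (0, (t : ℂ) * Complex.I)
  have hsub := closedBall_subset_Siegel hz ht ht1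
  set r := t / ((2 + 3 * m) * ‖z.2 + Complex.I‖) with hr
  have hr0 : 0 < r := by positivity
  have hvol : volume (Metric.closedBall w r) = ENNReal.ofReal (r ^ d) * κ :=
    Measure.addHaar_closedBall _ _ hr0.le
  have hpt : ∀ x : SPoint m, ‖f x‖ₑ ≤ 1 + ENNReal.ofReal (‖f x‖ ^ p) := by
    intro x
    rw [← ofReal_norm, ← ENNReal.ofReal_one, ← ENNReal.ofReal_add zero_le_one (by positivity)]
    apply ENNReal.ofReal_le_ofReal
    rcases le_total ‖f x‖ 1 with h | h
    · have : 0 ≤ ‖f x‖ ^ p := by positivity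
      linarith
    · linarith [Real.self_le_rpow_of_one_le h hp]
  have hmain : ‖f w‖ₑ * (ENNReal.ofReal (r ^ d) * κ) ≤ ENNReal.ofReal (r ^ d) * κ + K := by
    rw [← hvol]
    refine (enorm_mul_volume_closedBall_le (isOpen_Siegel m) hd hsub).trans ?_
    refine (lintegral_mono hpt).trans ?_
    rw [lintegral_add_left measurable_const, setLIntegral_const, one_mul]
    gcongr
    exact lintegral_mono_set hsub
  have hreal := ENNReal.toReal_mono (by finiteness) hmain
  rw [ENNReal.toReal_add (by finiteness) hKtop, ENNReal.toReal_mul, ENNReal.toReal_mul,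
    ENNReal.toReal_ofReal (by positivity), toReal_enorm] at hreal
  have hrd : r ^ d = (t / (2 + 3 * m)) ^ d / A ^ d := by
    rw [hr, ← div_div, div_pow]
  have hAd : 1 ≤ A ^ d := one_le_pow₀ hA1
  set q := (t / (2 + 3 * m)) ^ d with hq
  have hq0 : 0 < q := by positivity
  have h1 : ‖f w‖ ≤ 1 + K.toReal / (r ^ d * κ.toReal) := by
    rw [← sub_le_iff_le_add', le_div_iff₀ (by positivity)]
    linarith
  refine h1.trans ?_
  rw [hrd, add_mul, one_mul]
  refine add_le_add hAd (le_of_eq ?_)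
  field_simp

theorem one_le_norm_one_sub_I_mul {t : ℝ} (ht : 0 ≤ t) {w : ℂ} (hw : 0 ≤ w.im) :
    1 ≤ ‖1 - Complex.I * (t * w)‖ := by
  have h := (le_abs_self _).trans (Complex.abs_re_le_norm (1 - Complex.I * (t * w)))
  simp at h
  nlinarith [mul_nonneg ht hw]

theorem mul_norm_add_I_le_norm_one_sub_I_mul {t : ℝ} (ht : 0 ≤ t) (ht1 : t ≤ 1) {w : ℂ}
    (hw : 0 ≤ w.im) : t * ‖w + Complex.I‖ ≤ ‖1 - Complex.I * (t * w)‖ := by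
  have h : t * ‖w + Complex.I‖ = ‖(t : ℂ) * (w + Complex.I)‖ := by
    rw [norm_mul, Complex.norm_of_nonneg ht]
  rw [h, Complex.norm_def, Complex.norm_def]
  apply Real.sqrt_le_sqrt
  simp [Complex.normSq_apply]
  nlinarith [mul_nonneg ht hw]

theorem translate_mem_Siegel {m : ℕ} {z : SPoint m} (hz : z ∈ Siegel m) {t : ℝ} (ht : 0 ≤ t) :
    z + (0, (t : ℂ) * Complex.I) ∈ Siegel m := by
  change 0 < srho _
  rw [srho_add_I_mul]
  exact add_pos_of_pos_of_nonneg hz ht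

/-- The vertical translate of `f`, damped by a negative power of `1 - i t zₙ`. -/
noncomputable def dampedTranslate {m : ℕ} (f : SPoint m → ℂ) (t : ℝ) (N : ℕ) (z : SPoint m) : ℂ :=
  f (z + (0, (t : ℂ) * Complex.I)) * ((1 - Complex.I * (t * z.2)) ^ N)⁻¹

theorem differentiableOn_dampedTranslate {m : ℕ} {f : SPoint m → ℂ}
    (hd : DifferentiableOn ℂ f (Siegel m)) {t : ℝ} (ht : 0 ≤ t) (N : ℕ) :
    DifferentiableOn ℂ (dampedTranslate f t N) (Siegel m) := by
  refine DifferentiableOn.mul ?_ (DifferentiableOn.inv (by fun_prop) fun z hz => ?_)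
  · exact hd.comp (by fun_prop) fun z hz => translate_mem_Siegel hz ht
  · refine pow_ne_zero _ (norm_pos_iff.1 ?_)
    exact one_pos.trans_le (one_le_norm_one_sub_I_mul ht (im_pos_of_mem_Siegel hz).le)

theorem norm_dampedTranslate_le {m : ℕ} (f : SPoint m → ℂ) {t : ℝ} (ht : 0 ≤ t) (N : ℕ)
    {z : SPoint m} (hz : z ∈ Siegel m) :
    ‖dampedTranslate f t N z‖ ≤ ‖f (z + (0, (t : ℂ) * Complex.I))‖ := by
  rw [dampedTranslate, norm_mul, norm_inv, norm_pow]
  refine mul_le_of_le_one_right (norm_nonneg _) (inv_le_one_of_one_le₀ (one_le_pow₀ ?_))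
  exact one_le_norm_one_sub_I_mul ht (im_pos_of_mem_Siegel hz).le

theorem lintegral_dampedTranslate_le {m : ℕ} (f : SPoint m → ℂ) {p : ℝ} (hp : 0 ≤ p) {t : ℝ}
    (ht : 0 ≤ t) (N : ℕ) :
    ∫⁻ z in Siegel m, ‖dampedTranslate f t N z‖ₑ ^ p ≤ ∫⁻ z in Siegel m, ‖f z‖ₑ ^ p := by
  have hU := (isOpen_Siegel m).measurableSet
  rw [← lintegral_indicator hU, ← lintegral_indicator hU,
    ← lintegral_add_right_eq_self ((Siegel m).indicator fun z => ‖f z‖ₑ ^ p)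
      ((0, (t : ℂ) * Complex.I) : SPoint m)]
  refine lintegral_mono fun z => ?_
  by_cases hz : z ∈ Siegel m
  · rw [Set.indicator_of_mem hz, Set.indicator_of_mem (translate_mem_Siegel hz ht)]
    exact ENNReal.rpow_le_rpow (enorm_le_iff_norm_le.2 (norm_dampedTranslate_le f ht N hz)) hp
  · rw [Set.indicator_of_notMem hz]
    exact zero_le

theorem tendsto_dampedTranslate {m : ℕ} {f : SPoint m → ℂ}
    (hd : DifferentiableOn ℂ f (Siegel m)) {z : SPoint m} (hz : z ∈ Siegel m) {t : ℕ → ℝ}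
    (ht : Tendsto t atTop (nhds 0)) (N : ℕ) :
    Tendsto (fun k => dampedTranslate f (t k) N z) atTop (nhds (f z)) := by
  have hf : ContinuousAt f z := hd.continuousOn.continuousAt ((isOpen_Siegel m).mem_nhds hz)
  have hcont : ContinuousAt (fun s : ℝ => dampedTranslate f s N z) 0 := by
    refine ContinuousAt.mul ?_ (ContinuousAt.inv₀ (by fun_prop) (by simp))
    refine ContinuousAt.comp (g := f) (f := fun s : ℝ => z + (0, (s : ℂ) * Complex.I)) ?_
      (by fun_prop)
    simpa [← Prod.zero_eq_mk] using hf
  have h0 : dampedTranslate f 0 N z = f z := by simp [dampedTranslate, ← Prod.zero_eq_mk]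
  rw [← h0]
  exact hcont.tendsto.comp ht

theorem SAlpha_dampedTranslate {n : ℕ} {α : ℝ} {f : SPoint (n - 1) → ℂ}
    (hd : DifferentiableOn ℂ f (Siegel (n - 1))) {t : ℝ} (ht : 0 < t) (ht1 : t ≤ 1)
    {C : ℝ} {d : ℕ} (hC : ∀ z ∈ Siegel (n - 1),
      ‖f (z + (0, (t : ℂ) * Complex.I))‖ ≤ C * ‖z.2 + Complex.I‖ ^ d)
    {N : ℕ} (hN : α + d ≤ N) : SAlpha n α (dampedTranslate f t N) := by
  refine ⟨differentiableOn_dampedTranslate hd ht.le N, C / t ^ N, fun z hz => ?_⟩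
  have him := im_pos_of_mem_Siegel hz
  have hfz := hC z hz
  have hdamp := mul_norm_add_I_le_norm_one_sub_I_mul ht.le ht1 him.le
  set A := ‖z.2 + Complex.I‖ with hA
  have hA1 : 1 ≤ A := by linarith [im_add_one_le_norm_add_I z.2]
  have hA0 : 0 < A := one_pos.trans_le hA1
  have hC0 : 0 ≤ C := nonneg_of_mul_nonneg_left ((norm_nonneg _).trans hfz) (by positivity)
  rw [dampedTranslate, norm_mul, norm_inv, norm_pow]
  calc A ^ α * (‖f (z + (0, (t : ℂ) * Complex.I))‖ * (‖1 - Complex.I * (t * z.2)‖ ^ N)⁻¹)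
      ≤ A ^ α * (C * A ^ d * ((t * A) ^ N)⁻¹) := by gcongr
    _ = C / t ^ N * (A ^ (α + d) / A ^ (N : ℝ)) := by
        rw [Real.rpow_add hA0, Real.rpow_natCast, Real.rpow_natCast, mul_pow]
        field_simp
    _ ≤ C / t ^ N := by
        refine mul_le_of_le_one_right (by positivity) ((div_le_one (by positivity)).2 ?_)
        exact Real.rpow_le_rpow_of_exponent_le hA1 hN

/-- for `1 ≤ p < ∞` and `α > n + 1/p`, `𝒮_α ⊆ Aᵖ(𝒰)` and `𝒮_α` is
dense in `Aᵖ(𝒰)`. -/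
theorem Salpha_dense (n : ℕ) (hn : 1 ≤ n) (p : ℝ) (hp : 1 ≤ p) (α : ℝ)
    (hα : (n : ℝ) + 1 / p < α) :
    (∀ f : SPoint (n - 1) → ℂ, SAlpha n α f → MemAp n p f) ∧
      (∀ f : SPoint (n - 1) → ℂ, MemAp n p f → ∀ ε > (0 : ℝ),
        ∃ g : SPoint (n - 1) → ℂ, SAlpha n α g ∧
          ∫⁻ z in Siegel (n - 1), ENNReal.ofReal (‖f z - g z‖ ^ p) <
            ENNReal.ofReal (ε ^ p)) := by
  have hp0 : 0 < p := one_pos.trans_le hp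
  refine ⟨fun f hf => MemAp_of_SAlpha hn hp hα hf, ?_⟩
  rintro f ⟨hd, hint⟩ ε hε
  have hofReal : ∀ w : ℂ, ENNReal.ofReal (‖w‖ ^ p) = ‖w‖ₑ ^ p := fun w => by
    rw [← ENNReal.ofReal_rpow_of_nonneg (norm_nonneg w) hp0.le, ofReal_norm]
  have hU := (isOpen_Siegel (n - 1)).measurableSet
  have hfin : ∫⁻ z in Siegel (n - 1), ‖f z‖ₑ ^ p ≠ ⊤ := by
    simpa only [hofReal] using hint.lintegral_lt_top.ne
  have ht0 : ∀ k : ℕ, 0 < 1 / ((k : ℝ) + 1) := fun k => Nat.one_div_pos_of_nat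
  have ht1 : ∀ k : ℕ, 1 / ((k : ℝ) + 1) ≤ 1 := fun k =>
    (div_le_one (by positivity)).2 (by linarith [(Nat.cast_nonneg k : (0 : ℝ) ≤ k)])
  obtain ⟨N, hN⟩ := exists_nat_ge (α + Module.finrank ℝ (SPoint (n - 1)))
  have hconv := eventually_lintegral_norm_sub_rpow_lt (μ := volume.restrict (Siegel (n - 1)))
    (g := fun k : ℕ => dampedTranslate f (1 / ((k : ℝ) + 1)) N) hp
    (hd.continuousOn.aestronglyMeasurable hU)
    (fun k => (differentiableOn_dampedTranslate hd
      (ht0 k).le N).continuousOn.aestronglyMeasurable hU)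
    hfin (fun k => lintegral_dampedTranslate_le f hp0.le (ht0 k).le N)
    ((ae_restrict_mem hU).mono fun z hz =>
      tendsto_dampedTranslate hd hz tendsto_one_div_add_atTop_nhds_zero_nat N)
    (ENNReal.ofReal_pos.2 (Real.rpow_pos_of_pos hε p))
  obtain ⟨k, hk⟩ := hconv.exists
  obtain ⟨C, hC⟩ := exists_norm_translate_le hp hd hint (ht0 k) (ht1 k)
  refine ⟨_, SAlpha_dampedTranslate hd (ht0 k) (ht1 k) hC hN, ?_⟩
  simpa only [hofReal] using hk
end

section
/- Let μ be a positive Borel measure on 𝒰 such that ∫_𝒰 |wₙ + i|^{−α} dμ(w) < ∞ for some α > 0, and let f ∈ 𝒮_α. Then for every z ∈ 𝒰 one has ∫_𝒰 |K(z,w) f(w)| dμ(w) < ∞; in particular the Toeplitz operator T_μ f(z) = ∫_𝒰 K(z,w) f(w) dμ(w) is well defined at every point of 𝒰. -/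
open MeasureTheory Filter

/-- Twice the real part of `ρ(z,w)` dominates `ρ(z) + ρ(w)`. -/
theorem srho_add_srho_le {m : ℕ} (z w : SPoint m) :
    srho z + srho w ≤ 2 * (srho2 z w).re := by
  have hsum : 2 * ∑ j, (z.1 j * (starRingEnd ℂ) (w.1 j)).re
      ≤ ∑ j, ‖z.1 j‖ ^ 2 + ∑ j, ‖w.1 j‖ ^ 2 := by
    rw [Finset.mul_sum, ← Finset.sum_add_distrib]
    refine Finset.sum_le_sum fun j _ => ?_
    have hre := Complex.re_le_norm (z.1 j * (starRingEnd ℂ) (w.1 j))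
    rw [norm_mul, RCLike.norm_conj] at hre
    nlinarith [sq_nonneg (‖z.1 j‖ - ‖w.1 j‖)]
  have hre : (srho2 z w).re
      = (w.2.im + z.2.im) / 2 - ∑ j, (z.1 j * (starRingEnd ℂ) (w.1 j)).re := by
    rw [srho2, Complex.sub_re, Complex.re_sum, Complex.mul_re]
    simp
    ring
  rw [hre]
  unfold srho
  linarith

theorem srho_half_le_norm_srho2 {m : ℕ} (z : SPoint m) {w : SPoint m} (hw : w ∈ Siegel m) :
    srho z / 2 ≤ ‖srho2 z w‖ := by
  have hw' : 0 < srho w := hw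
  linarith [srho_add_srho_le z w, Complex.re_le_norm (srho2 z w)]

/-- For fixed `z ∈ 𝒰` the Bergman kernel `K(z,·)` is bounded on `𝒰`. -/
theorem norm_sK_le (n : ℕ) {z w : SPoint (n - 1)} (hz : z ∈ Siegel (n - 1))
    (hw : w ∈ Siegel (n - 1)) :
    ‖sK n z w‖ ≤ ‖(n.factorial : ℂ) / (4 * (Real.pi : ℂ) ^ n)‖ * ((srho z / 2) ^ (n + 1))⁻¹ := by
  have hz' : 0 < srho z := hz
  have hpow : srho2 z w ^ (-(n + 1 : ℤ)) = (srho2 z w ^ (n + 1))⁻¹ := by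
    rw [zpow_neg]
    norm_cast
  rw [sK, norm_mul, hpow, norm_inv, norm_pow]
  gcongr
  exact srho_half_le_norm_srho2 z hw

theorem SAlpha.exists_norm_le {n : ℕ} {α : ℝ} {f : SPoint (n - 1) → ℂ} (hf : SAlpha n α f) :
    ∃ M : ℝ, ∀ w ∈ Siegel (n - 1), ‖f w‖ ≤ M * ‖w.2 + Complex.I‖ ^ (-α) := by
  obtain ⟨-, M, hM⟩ := hf
  refine ⟨M, fun w hw => ?_⟩
  have him : 0 < w.2.im := by
    have hw' : 0 < w.2.im - ∑ j, ‖w.1 j‖ ^ 2 := hw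
    have : 0 ≤ ∑ j, ‖w.1 j‖ ^ 2 := Finset.sum_nonneg fun j _ => sq_nonneg _
    linarith
  have hpos : 0 < ‖w.2 + Complex.I‖ := by
    refine norm_pos_iff.2 fun h => ?_
    have := congrArg Complex.im h
    simp at this
    linarith
  rw [Real.rpow_neg hpos.le, ← div_eq_mul_inv, le_div_iff₀ (Real.rpow_pos_of_pos hpos α), mul_comm]
  exact hM w hw

/-- if `∫_𝒰 |wₙ+i|^{−α} dμ < ∞` for some `α > 0` and `f ∈ 𝒮_α`, then
`∫_𝒰 |K(z,w) f(w)| dμ(w) < ∞` for every `z ∈ 𝒰`, so `T_μ f` is well defined. -/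
theorem toeplitz_well_defined (n : ℕ) (hn : 1 ≤ n) (μ : Measure (SPoint (n - 1)))
    (α : ℝ) (hα : 0 < α)
    (hμ : ∫⁻ w in Siegel (n - 1),
        ENNReal.ofReal (‖w.2 + Complex.I‖ ^ (-α)) ∂μ < ⊤)
    (f : SPoint (n - 1) → ℂ) (hf : SAlpha n α f) (z : SPoint (n - 1))
    (hz : z ∈ Siegel (n - 1)) :
    ∫⁻ w in Siegel (n - 1),
        ENNReal.ofReal (‖sK n z w * f w‖) ∂μ < ⊤ := by
  obtain ⟨M, hM⟩ := hf.exists_norm_le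
  set C := ‖(n.factorial : ℂ) / (4 * (Real.pi : ℂ) ^ n)‖ * ((srho z / 2) ^ (n + 1))⁻¹
  calc ∫⁻ w in Siegel (n - 1), ENNReal.ofReal (‖sK n z w * f w‖) ∂μ
      ≤ ∫⁻ w in Siegel (n - 1),
          ENNReal.ofReal (C * M) * ENNReal.ofReal (‖w.2 + Complex.I‖ ^ (-α)) ∂μ := by
        refine setLIntegral_mono' (isOpen_Siegel _).measurableSet fun w hw => ?_
        rw [← ENNReal.ofReal_mul' (by positivity), norm_mul, mul_assoc]
        have hK : ‖sK n z w‖ ≤ C := norm_sK_le n hz hw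
        exact ENNReal.ofReal_le_ofReal
          (mul_le_mul hK (hM w hw) (norm_nonneg _) ((norm_nonneg _).trans hK))
    _ = ENNReal.ofReal (C * M) *
          ∫⁻ w in Siegel (n - 1), ENNReal.ofReal (‖w.2 + Complex.I‖ ^ (-α)) ∂μ :=
        lintegral_const_mul' _ _ ENNReal.ofReal_ne_top
    _ < ⊤ := ENNReal.mul_lt_top ENNReal.ofReal_lt_top hμ
end
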